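/- Let n ≥ m ≥ 1, ρ > 0, k ∈ ℝ and ν > 0 with ν/2 + k > 0, and τ = (t₁, …, t_m) ∈ ℝ^m with n/2 + t_i − (i−1)/2 > 0 for all i. Suppose the random n×m real matrix T has the matrix multivariate T-Riesz type I distribution MTR^I(ν, k, τ, ρ, 0, I_n, I_m). Then the random vector (α₁, …, α_m) of singular values of T (which almost surely satisfies α₁ > ⋯ > α_m > 0) has, with respect to Lebesgue measure on the region {α₁ > ⋯ > α_m > 0} ⊂ ℝ^m, the joint density c · ∏_{i=1}^m α_i^{n−m} · (1 + ρ Σ_{i=1}^m α_i²)^{−[(ν+mn)/2 + k + Σᵢtᵢ]} · ∏_{i<j}(α_i² − α_j²) · ∫_{O(m)} q_τ(H D_α² Hᵀ) dνₕ(H), where D_α = diag(α₁, …, α_m), νₕ is the normalized Haar probability measure on the orthogonal group O(m), and c = 2^m π^{m²/2} Γ((ν+mn)/2 + k + Σᵢtᵢ) ρ^{mn/2 + Σᵢtᵢ} / (Γ_m(m/2) Γ_m(n/2, τ) Γ(ν/2+k)). -/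

import Mathlib

open MeasureTheory Matrix Real

/-- Lebesgue (product) measure on `n × m` real matrices, via the identification with `ℝ^{nm}`. -/
noncomputable instance matMeasureSpace (n m : ℕ) : MeasureSpace (Matrix (Fin n) (Fin m) ℝ) :=
  (inferInstance : MeasureSpace (Fin n → Fin m → ℝ))

/-- Determinant of the leading principal `(i+1) × (i+1)` submatrix. -/
noncomputable def princMinor {m : ℕ} (A : Matrix (Fin m) (Fin m) ℝ) (i : Fin m) : ℝ :=
  (A.submatrix (fun j : Fin (i.1 + 1) => Fin.castLE i.isLt j)
    (fun j : Fin (i.1 + 1) => Fin.castLE i.isLt j)).det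

/-- The highest weight vector (generalized power)
`q_κ(A) = det(A)^{k_m} ∏_{i=1}^{m-1} det(A_i)^{k_i - k_{i+1}}`. -/
noncomputable def hwv {m : ℕ} (κ : Fin m → ℝ) (A : Matrix (Fin m) (Fin m) ℝ) : ℝ :=
  ∏ i : Fin m, princMinor A i ^ (if h : i.1 + 1 < m then κ i - κ ⟨i.1 + 1, h⟩ else κ i)

/-- The real multivariate gamma function `Γ_m(a) = π^{m(m-1)/4} ∏ Γ(a - (i-1)/2)`. -/
noncomputable def mvGamma (m : ℕ) (a : ℝ) : ℝ :=
  Real.pi ^ (((m * (m - 1) : ℕ) : ℝ) / 4) * ∏ i : Fin m, Real.Gamma (a - (i : ℝ) / 2)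

/-- The generalized gamma function of weight `τ`:
`Γ_m(a, τ) = π^{m(m-1)/4} ∏ Γ(a + t_i - (i-1)/2)`. -/
noncomputable def mvGammaI (m : ℕ) (a : ℝ) (τ : Fin m → ℝ) : ℝ :=
  Real.pi ^ (((m * (m - 1) : ℕ) : ℝ) / 4) * ∏ i : Fin m, Real.Gamma (a + τ i - (i : ℝ) / 2)

/-- The generalized gamma function of weight `-τ`:
`Γ_m(a, -τ) = π^{m(m-1)/4} ∏ Γ(a - t_i - (m-i)/2)`. -/
noncomputable def mvGammaII (m : ℕ) (a : ℝ) (τ : Fin m → ℝ) : ℝ :=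
  Real.pi ^ (((m * (m - 1) : ℕ) : ℝ) / 4) *
    ∏ i : Fin m, Real.Gamma (a - τ i - ((m : ℝ) - 1 - (i : ℝ)) / 2)

/-- Lebesgue measure on `m × m` real symmetric matrices: the pushforward of the product
Lebesgue measure in the coordinates `(x_{ij})_{i ≤ j}` under the obvious parametrization. -/
noncomputable def symmVol (m : ℕ) : Measure (Matrix (Fin m) (Fin m) ℝ) :=
  Measure.map (fun f : {p : Fin m × Fin m // p.1 ≤ p.2} → ℝ =>
    Matrix.of fun i j => if h : i ≤ j then f ⟨(i, j), h⟩ else f ⟨(j, i), le_of_not_ge h⟩) volume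

/-- The eigenvalues of `XᵀX`, arranged in decreasing order. -/
noncomputable def sortedEigs {n m : ℕ} (X : Matrix (Fin n) (Fin m) ℝ) : Fin m → ℝ :=
  fun i =>
    ((Matrix.isHermitian_conjTranspose_mul_self X).eigenvalues ∘
      Tuple.sort (Matrix.isHermitian_conjTranspose_mul_self X).eigenvalues) (Fin.rev i)

/-- The singular values of an `n × m` real matrix, in decreasing order. -/
noncomputable def svalues {n m : ℕ} (X : Matrix (Fin n) (Fin m) ℝ) : Fin m → ℝ :=
  fun i => Real.sqrt (sortedEigs X i)

/-- The Kotz-Riesz type I density `KR^I_{n×m}(τ, μ, Θ, Σ)` (with `U = u(Σ)` the upper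
triangular Cholesky factor of `Σ`, supplied explicitly). -/
noncomputable def kotzRieszIDen (n m : ℕ) (τ : Fin m → ℝ) (μ : Matrix (Fin n) (Fin m) ℝ)
    (Θ : Matrix (Fin n) (Fin n) ℝ) (Sig U : Matrix (Fin m) (Fin m) ℝ)
    (y : Matrix (Fin n) (Fin m) ℝ) : ℝ :=
  mvGamma m ((n : ℝ) / 2) /
      (Real.pi ^ (((m * n : ℕ) : ℝ) / 2) * mvGammaI m ((n : ℝ) / 2) τ *
        Sig.det ^ ((n : ℝ) / 2) * Θ.det ^ ((m : ℝ) / 2)) *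
    Real.exp (-(Sig⁻¹ * (y - μ)ᵀ * Θ⁻¹ * (y - μ)).trace) *
    hwv τ ((Uᵀ)⁻¹ * (y - μ)ᵀ * Θ⁻¹ * (y - μ) * U⁻¹)

/-- The Kotz-Riesz type II density `KR^{II}_{n×m}(τ, μ, Θ, Σ)` (with `U = u(Σ)` the upper
triangular Cholesky factor of `Σ`, supplied explicitly). -/
noncomputable def kotzRieszIIDen (n m : ℕ) (τ : Fin m → ℝ) (μ : Matrix (Fin n) (Fin m) ℝ)
    (Θ : Matrix (Fin n) (Fin n) ℝ) (Sig U : Matrix (Fin m) (Fin m) ℝ)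
    (y : Matrix (Fin n) (Fin m) ℝ) : ℝ :=
  mvGamma m ((n : ℝ) / 2) /
      (Real.pi ^ (((m * n : ℕ) : ℝ) / 2) * mvGammaII m ((n : ℝ) / 2) τ *
        Sig.det ^ ((n : ℝ) / 2) * Θ.det ^ ((m : ℝ) / 2)) *
    Real.exp (-(Sig⁻¹ * (y - μ)ᵀ * Θ⁻¹ * (y - μ)).trace) *
    hwv τ (((Uᵀ)⁻¹ * (y - μ)ᵀ * Θ⁻¹ * (y - μ) * U⁻¹)⁻¹)

/-- The matrix multivariate T-Riesz type I density
`MTR^I(ν, k, τ, ρ, μ, Θ, Σ)` (with `U = u(Σ)` supplied explicitly). -/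
noncomputable def tRieszIDen (n m : ℕ) (ν k ρ : ℝ) (τ : Fin m → ℝ)
    (μ : Matrix (Fin n) (Fin m) ℝ) (Θ : Matrix (Fin n) (Fin n) ℝ)
    (Sig U : Matrix (Fin m) (Fin m) ℝ) (t : Matrix (Fin n) (Fin m) ℝ) : ℝ :=
  mvGamma m ((n : ℝ) / 2) * Real.Gamma ((ν + (m * n : ℕ)) / 2 + k + ∑ i, τ i) *
      ρ ^ (((m * n : ℕ) : ℝ) / 2 + ∑ i, τ i) /
      (Real.pi ^ (((m * n : ℕ) : ℝ) / 2) * mvGammaI m ((n : ℝ) / 2) τ *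
        Real.Gamma (ν / 2 + k) * Sig.det ^ ((n : ℝ) / 2) * Θ.det ^ ((m : ℝ) / 2)) *
    (1 + ρ * (Sig⁻¹ * (t - μ)ᵀ * Θ⁻¹ * (t - μ)).trace) ^
      (-((ν + (m * n : ℕ)) / 2 + k + ∑ i, τ i)) *
    hwv τ ((Uᵀ)⁻¹ * (t - μ)ᵀ * Θ⁻¹ * (t - μ) * U⁻¹)

/-- The matrix multivariate T-Riesz type II density
`MTR^{II}(ν, k, τ, ρ, μ, Θ, Σ)` (with `U = u(Σ)` supplied explicitly). -/
noncomputable def tRieszIIDen (n m : ℕ) (ν k ρ : ℝ) (τ : Fin m → ℝ)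
    (μ : Matrix (Fin n) (Fin m) ℝ) (Θ : Matrix (Fin n) (Fin n) ℝ)
    (Sig U : Matrix (Fin m) (Fin m) ℝ) (t : Matrix (Fin n) (Fin m) ℝ) : ℝ :=
  mvGamma m ((n : ℝ) / 2) * Real.Gamma ((ν + (m * n : ℕ)) / 2 - k - ∑ i, τ i) *
      ρ ^ (((m * n : ℕ) : ℝ) / 2 - ∑ i, τ i) /
      (Real.pi ^ (((m * n : ℕ) : ℝ) / 2) * mvGammaII m ((n : ℝ) / 2) τ *
        Real.Gamma (ν / 2 - k) * Sig.det ^ ((n : ℝ) / 2) * Θ.det ^ ((m : ℝ) / 2)) *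
    (1 + ρ * (Sig⁻¹ * (t - μ)ᵀ * Θ⁻¹ * (t - μ)).trace) ^
      (-((ν + (m * n : ℕ)) / 2 - k - ∑ i, τ i)) *
    hwv τ (((Uᵀ)⁻¹ * (t - μ)ᵀ * Θ⁻¹ * (t - μ) * U⁻¹)⁻¹)

theorem lintegral_pi_fin_prod {m : ℕ} (f : Fin m → ℝ → ENNReal) (hf : ∀ i, Measurable (f i)) :
    ∫⁻ x : Fin m → ℝ, ∏ i, f i (x i) = ∏ i, ∫⁻ t, f i t := by
  induction m with
  | zero => simp [volume_pi]
  | succ m ih =>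
    have e := (volume_preserving_piFinSuccAbove (fun _ : Fin (m + 1) => ℝ) 0).symm
    rw [← e.lintegral_comp_emb (MeasurableEquiv.measurableEmbedding _)]
    simp only [MeasurableEquiv.piFinSuccAbove_symm_apply, Fin.insertNthEquiv,
      Fin.prod_univ_succ, Fin.insertNth_zero, Equiv.coe_fn_mk, Fin.cons_succ, Fin.cons_zero,
      Fin.zero_succAbove, cast_eq]
    rw [Measure.volume_eq_prod, lintegral_prod_mul (f := f 0)
      (g := fun y : Fin m → ℝ => ∏ i, f i.succ (y i)) (hf 0).aemeasurable
      (Finset.measurable_prod _ fun i _ => (hf i.succ).comp (measurable_pi_apply i)).aemeasurable,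
      ih _ fun i => hf i.succ]

theorem pi_withDensity_eq {m : ℕ} (h : ℝ → ENNReal) (hh : Measurable h)
    [SigmaFinite ((volume : Measure ℝ).withDensity h)] :
    (volume : Measure (Fin m → ℝ)).withDensity (fun x => ∏ i, h (x i)) =
      Measure.pi fun _ : Fin m => (volume : Measure ℝ).withDensity h := by
  refine (Measure.pi_eq fun s hs => ?_).symm
  rw [withDensity_apply _ (MeasurableSet.univ_pi hs),
    ← lintegral_indicator (MeasurableSet.univ_pi hs)]
  have : ∀ x : Fin m → ℝ, (Set.univ.pi s).indicator (fun x => ∏ i, h (x i)) x =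
      ∏ i, (s i).indicator h (x i) := by
    intro x
    by_cases hx : x ∈ Set.univ.pi s
    · rw [Set.indicator_of_mem hx]
      exact Finset.prod_congr rfl fun i _ => (Set.indicator_of_mem (hx i trivial) _).symm
    · rw [Set.indicator_of_notMem hx]
      simp only [Set.mem_univ_pi, not_forall] at hx
      obtain ⟨i, hi⟩ := hx
      exact (Finset.prod_eq_zero (Finset.mem_univ i) (Set.indicator_of_notMem hi _)).symm
  simp_rw [this]
  rw [lintegral_pi_fin_prod _ fun i => hh.indicator (hs i)]
  exact Finset.prod_congr rfl fun i _ => by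
    rw [lintegral_indicator (hs i), withDensity_apply _ (hs i)]

/-- A coordinatewise change of variables, given its one-dimensional version. -/
theorem lintegral_pi_comp_of_map_withDensity {m : ℕ} {φ : ℝ → ℝ} (hφ : Measurable φ)
    {g h : ℝ → ENNReal} (hg : Measurable g) (hh : Measurable h)
    [SigmaFinite ((volume : Measure ℝ).withDensity g)]
    [SigmaFinite ((volume : Measure ℝ).withDensity h)]
    (hmap : ((volume : Measure ℝ).withDensity g).map φ = volume.withDensity h)
    {F : (Fin m → ℝ) → ENNReal} (hF : Measurable F) :
    ∫⁻ y : Fin m → ℝ, (∏ i, g (y i)) * F (fun i => φ (y i)) =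
      ∫⁻ p : Fin m → ℝ, (∏ i, h (p i)) * F p := by
  have hpi : ∀ {h : ℝ → ENNReal}, Measurable h →
      Measurable fun x : Fin m → ℝ => ∏ i, h (x i) := fun hh =>
    Finset.measurable_prod _ fun i _ => hh.comp (measurable_pi_apply i)
  have hΦ : Measurable fun (y : Fin m → ℝ) i => φ (y i) :=
    measurable_pi_lambda _ fun i => hφ.comp (measurable_pi_apply i)
  have : SigmaFinite (((volume : Measure ℝ).withDensity g).map φ) := by
    rw [hmap]; infer_instance
  have := Measure.pi_map_pi (μ := fun _ : Fin m => (volume : Measure ℝ).withDensity g)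
    (f := fun _ => φ) fun _ => hφ.aemeasurable
  rw [hmap, ← pi_withDensity_eq g hg, ← pi_withDensity_eq h hh] at this
  have h2 := congrArg (fun μ => ∫⁻ p, F p ∂μ) this
  simp only [lintegral_map hF hΦ] at h2
  rw [lintegral_withDensity_eq_lintegral_mul _ (hpi hg)
      (show Measurable fun y : Fin m → ℝ => F fun i => φ (y i) from hF.comp hΦ),
    lintegral_withDensity_eq_lintegral_mul _ (hpi hh) hF] at h2
  exact h2

theorem sigmaFinite_withDensity_indicator_ofReal (s : Set ℝ) (f : ℝ → ℝ) :
    SigmaFinite ((volume : Measure ℝ).withDensity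
      (s.indicator fun t => ENNReal.ofReal (f t))) := by
  refine SigmaFinite.withDensity_of_ne_top (ae_of_all _ fun t => ?_)
  by_cases h : t ∈ s <;> simp [h]

theorem lintegral_Ioi_comp_sq (g : ℝ → ENNReal) :
    ∫⁻ p in Set.Ioi (0 : ℝ), g p = ∫⁻ t in Set.Ioi (0 : ℝ), ENNReal.ofReal (2 * t) * g (t ^ 2) := by
  have him : (fun t : ℝ => t ^ 2) '' Set.Ioi 0 = Set.Ioi 0 := by
    ext p
    simp only [Set.mem_image, Set.mem_Ioi]
    exact ⟨fun ⟨t, ht, h⟩ => h ▸ by positivity, fun hp => ⟨√p, Real.sqrt_pos.2 hp,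
      Real.sq_sqrt hp.le⟩⟩
  have := lintegral_image_eq_lintegral_abs_deriv_mul (f := fun t : ℝ => t ^ 2)
    (f' := fun t => 2 * t) (s := Set.Ioi 0) measurableSet_Ioi
    (fun t _ => by simpa using (hasDerivAt_pow 2 t).hasDerivWithinAt)
    (fun a ha b hb h => by
      simp only [Set.mem_Ioi] at ha hb
      exact (pow_left_inj₀ ha.le hb.le two_ne_zero).1 h) g
  rw [him] at this
  rw [this]
  refine setLIntegral_congr_fun measurableSet_Ioi fun t ht => ?_
  rw [Set.mem_Ioi] at ht
  rw [abs_of_pos (by positivity)]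

theorem lintegral_comp_abs (g : ℝ → ENNReal) (hg : Measurable g) :
    ∫⁻ t : ℝ, g |t| = 2 * ∫⁻ t in Set.Ioi (0 : ℝ), g t := by
  have h1 : ∫⁻ t in Set.Ioi (0 : ℝ), g |t| = ∫⁻ t in Set.Ioi (0 : ℝ), g t :=
    setLIntegral_congr_fun measurableSet_Ioi fun t ht => by
      simp only [Set.mem_Ioi] at ht; simp only [abs_of_pos ht]
  have h2 : ∫⁻ t in (Set.Ioi (0 : ℝ))ᶜ, g |t| = ∫⁻ t in Set.Ioi (0 : ℝ), g t := by
    rw [Set.compl_Ioi, restrict_Iio_eq_restrict_Iic.symm, ← h1,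
      ← (Measure.measurePreserving_neg (volume : Measure ℝ)).setLIntegral_comp_preimage
        measurableSet_Iio (f := fun t => g |t|) (hg.comp measurable_abs)]
    simp
  rw [← lintegral_add_compl _ measurableSet_Ioi, h1, h2, two_mul]

theorem map_sq_volume :
    ((volume : Measure ℝ).withDensity fun _ => 1).map (fun t => t ^ 2) =
      volume.withDensity ((Set.Ioi 0).indicator fun p => ENNReal.ofReal (p ^ (-(1 / 2) : ℝ))) := by
  have hm : Measurable fun p : ℝ => ENNReal.ofReal (p ^ (-(1 / 2) : ℝ)) := by fun_prop
  refine Measure.ext_of_lintegral _ fun f hf => ?_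
  rw [lintegral_map hf (by fun_prop),
    lintegral_withDensity_eq_lintegral_mul _ measurable_const (by fun_prop),
    lintegral_withDensity_eq_lintegral_mul _ (hm.indicator measurableSet_Ioi) hf]
  simp only [Pi.mul_apply, one_mul, ← Set.indicator_mul_left]
  rw [lintegral_indicator measurableSet_Ioi, lintegral_Ioi_comp_sq]
  have := lintegral_comp_abs (fun t => f (t ^ 2)) (by fun_prop)
  simp only [sq_abs] at this
  rw [this, ← lintegral_const_mul _ (by fun_prop)]
  refine setLIntegral_congr_fun measurableSet_Ioi fun t ht => ?_
  rw [Set.mem_Ioi] at ht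
  rw [← mul_assoc, ← ENNReal.ofReal_mul (by positivity), ← Real.rpow_natCast, ← Real.rpow_mul ht.le]
  have : 2 * t * t ^ (((2 : ℕ) : ℝ) * -(1 / 2)) = 2 := by
    norm_num [Real.rpow_neg_one, ht.ne']
  rw [this]; simp

theorem map_sq_Ioi :
    ((volume : Measure ℝ).withDensity
      ((Set.Ioi 0).indicator fun t => ENNReal.ofReal (2 * t))).map (fun t => t ^ 2) =
      volume.withDensity ((Set.Ioi 0).indicator fun _ => ENNReal.ofReal 1) := by
  have hm : Measurable fun p : ℝ => ENNReal.ofReal (2 * p) := by fun_prop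
  refine Measure.ext_of_lintegral _ fun f hf => ?_
  rw [lintegral_map hf (by fun_prop),
    lintegral_withDensity_eq_lintegral_mul _ (hm.indicator measurableSet_Ioi) (by fun_prop),
    lintegral_withDensity_eq_lintegral_mul _ (measurable_const.indicator measurableSet_Ioi) hf]
  simp only [Pi.mul_apply]
  simp only [← Set.indicator_mul_left _ (fun p => ENNReal.ofReal (2 * p)) fun a => f (a ^ 2),
    ← Set.indicator_mul_left _ (fun _ : ℝ => ENNReal.ofReal 1)]
  rw [lintegral_indicator measurableSet_Ioi, lintegral_indicator measurableSet_Ioi]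
  simp [lintegral_Ioi_comp_sq f]

theorem prod_indicator_univ {m : ℕ} (s : Set ℝ) (f : ℝ → ENNReal) (p : Fin m → ℝ) :
    ∏ i, s.indicator f (p i) = {p : Fin m → ℝ | ∀ i, p i ∈ s}.indicator
      (fun p => ∏ i, f (p i)) p := by
  by_cases h : ∀ i, p i ∈ s
  · rw [Set.indicator_of_mem (show p ∈ {p : Fin m → ℝ | ∀ i, p i ∈ s} from h)]
    exact Finset.prod_congr rfl fun i _ => Set.indicator_of_mem (h i) _
  · rw [Set.indicator_of_notMem (show p ∉ {p : Fin m → ℝ | ∀ i, p i ∈ s} from h)]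
    push Not at h
    obtain ⟨i, hi⟩ := h
    exact Finset.prod_eq_zero (Finset.mem_univ i) (Set.indicator_of_notMem hi _)

theorem measurableSet_forall_pos (m : ℕ) : MeasurableSet {p : Fin m → ℝ | ∀ i, 0 < p i} := by
  have := MeasurableSet.univ_pi (t := fun _ : Fin m => Set.Ioi (0 : ℝ))
    fun _ => measurableSet_Ioi
  simpa [Set.pi] using this

/-- The law of the squared coordinates under Lebesgue measure. -/
theorem lintegral_comp_sq_pi {m : ℕ} {F : (Fin m → ℝ) → ENNReal} (hF : Measurable F) :
    ∫⁻ y : Fin m → ℝ, F (fun i => y i ^ 2) =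
      ∫⁻ p in {p : Fin m → ℝ | ∀ i, 0 < p i},
        (∏ i, ENNReal.ofReal (p i ^ (-(1 / 2) : ℝ))) * F p := by
  have := sigmaFinite_withDensity_indicator_ofReal (Set.Ioi 0)
    (fun p => p ^ (-(1 / 2) : ℝ))
  have : SigmaFinite ((volume : Measure ℝ).withDensity fun _ => (1 : ENNReal)) := by
    simp only [withDensity_const, one_smul]; infer_instance
  have := lintegral_pi_comp_of_map_withDensity (m := m) (by fun_prop) measurable_const
    ((show Measurable fun p : ℝ => ENNReal.ofReal (p ^ (-(1 / 2) : ℝ)) by fun_prop).indicator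
      measurableSet_Ioi) map_sq_volume hF
  simp only [Finset.prod_const_one, one_mul, prod_indicator_univ, Set.mem_Ioi] at this
  rw [this, ← lintegral_indicator (measurableSet_forall_pos m)]
  simp only [Set.indicator_mul_left]

/-- The substitution `p = α²` on the positive orthant. -/
theorem lintegral_pos_comp_sq_pi {m : ℕ} {F : (Fin m → ℝ) → ENNReal} (hF : Measurable F) :
    ∫⁻ p in {p : Fin m → ℝ | ∀ i, 0 < p i}, F p =
      ∫⁻ a in {p : Fin m → ℝ | ∀ i, 0 < p i},
        (∏ i, ENNReal.ofReal (2 * a i)) * F (fun i => a i ^ 2) := by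
  have := sigmaFinite_withDensity_indicator_ofReal (Set.Ioi 0)
    (fun p => 2 * p)
  have := sigmaFinite_withDensity_indicator_ofReal (Set.Ioi 0)
    (fun _ => 1)
  have := lintegral_pi_comp_of_map_withDensity (m := m) (by fun_prop)
    ((show Measurable fun p : ℝ => ENNReal.ofReal (2 * p) by fun_prop).indicator
      measurableSet_Ioi) (measurable_const.indicator measurableSet_Ioi) map_sq_Ioi hF
  simp only [prod_indicator_univ, Set.mem_Ioi] at this
  rw [← lintegral_indicator (measurableSet_forall_pos m),
    ← lintegral_indicator (measurableSet_forall_pos m)]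
  simp only [Set.indicator_mul_left, this]
  simp only [ENNReal.ofReal_one, Finset.prod_const_one]
  refine lintegral_congr fun p => ?_
  rw [← Set.indicator_mul_left]
  simp only [one_mul]

theorem lintegral_comp_norm {E : Type*} [NormedAddCommGroup E] [NormedSpace ℝ E]
    [MeasurableSpace E] [BorelSpace E] [FiniteDimensional ℝ E] [Nontrivial E] (μ : Measure E)
    [μ.IsAddHaarMeasure] {f : ℝ → ENNReal} (hf : Measurable f) :
    ∫⁻ x, f ‖x‖ ∂μ = Module.finrank ℝ E * μ (Metric.ball 0 1) *
      ∫⁻ r in Set.Ioi (0 : ℝ), ENNReal.ofReal (r ^ (Module.finrank ℝ E - 1)) * f r := by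
  calc ∫⁻ x, f ‖x‖ ∂μ = ∫⁻ x : ({(0)}ᶜ : Set E), f ‖x.1‖ ∂(μ.comap (↑)) := by
        rw [lintegral_subtype_comap (measurableSet_singleton _).compl fun x ↦ f ‖x‖,
          restrict_compl_singleton]
    _ = ∫⁻ x, f x.2 ∂μ.toSphere.prod (.volumeIoiPow (Module.finrank ℝ E - 1)) := by
        simpa using μ.measurePreserving_homeomorphUnitSphereProd.lintegral_comp_emb
          (Homeomorph.measurableEmbedding _) (f ∘ Subtype.val ∘ Prod.snd)
    _ = μ.toSphere Set.univ *
          ∫⁻ x : Set.Ioi (0 : ℝ), f x ∂.volumeIoiPow (Module.finrank ℝ E - 1) := by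
        rw [lintegral_prod _ (by fun_prop)]
        simp [mul_comm]
    _ = _ := by
        rw [μ.toSphere_apply_univ, Measure.volumeIoiPow,
          lintegral_withDensity_eq_lintegral_mul _ (by fun_prop) (by fun_prop)]
        congr 1
        exact lintegral_subtype_comap measurableSet_Ioi
          fun a ↦ ENNReal.ofReal (a ^ (Module.finrank ℝ E - 1)) * f a

/-- The law of the squared norm under Lebesgue measure, up to folding. -/
theorem lintegral_comp_sum_sq {d : ℕ} (hd : 1 ≤ d) {g : ℝ → ENNReal} (hg : Measurable g) :
    ∫⁻ z : Fin d → ℝ, g (∑ i, z i ^ 2) =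
      ENNReal.ofReal (π ^ ((d : ℝ) / 2) / Real.Gamma (d / 2)) *
        ∫⁻ y : ℝ, ENNReal.ofReal ((y ^ 2) ^ (((d : ℝ) - 1) / 2)) * g (y ^ 2) := by
  have : Nonempty (Fin d) := ⟨⟨0, hd⟩⟩
  have h1 : ∫⁻ z : Fin d → ℝ, g (∑ i, z i ^ 2) =
      ∫⁻ x : EuclideanSpace ℝ (Fin d), g (‖x‖ ^ 2) := by
    rw [← (PiLp.volume_preserving_ofLp (Fin d)).lintegral_comp
      (f := fun z : Fin d → ℝ => g (∑ i, z i ^ 2)) (by fun_prop)]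
    refine lintegral_congr fun x => ?_
    rw [EuclideanSpace.norm_sq_eq]
    simp
  have h2 := lintegral_comp_abs (fun t => ENNReal.ofReal ((t ^ 2) ^ (((d : ℝ) - 1) / 2)) *
    g (t ^ 2)) (by fun_prop)
  simp only [sq_abs] at h2
  rw [h1, h2, lintegral_comp_norm volume (f := fun t => g (t ^ 2)) (by fun_prop),
    finrank_euclideanSpace, Fintype.card_fin, EuclideanSpace.volume_ball,
    ← mul_assoc (ENNReal.ofReal (π ^ ((d : ℝ) / 2) / Real.Gamma (d / 2)))]
  congr 1
  · have hd0 : (0 : ℝ) < d := by exact_mod_cast hd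
    rw [← ENNReal.ofReal_natCast, show (2 : ENNReal) = ENNReal.ofReal 2 by simp]
    simp only [ENNReal.ofReal_one, one_pow, one_mul, Fintype.card_fin]
    have hG := Real.Gamma_pos_of_pos (half_pos hd0)
    rw [← ENNReal.ofReal_mul hd0.le, ← ENNReal.ofReal_mul (by positivity)]
    congr 1
    rw [Real.Gamma_add_one (by positivity), Real.sqrt_eq_rpow, ← Real.rpow_natCast,
      ← Real.rpow_mul pi_pos.le, one_div_mul_eq_div]
    field_simp
  · refine setLIntegral_congr_fun measurableSet_Ioi fun t ht => ?_
    rw [Set.mem_Ioi] at ht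
    have : (t ^ 2) ^ (((d : ℝ) - 1) / 2) = t ^ (d - 1) := by
      rw [← Real.rpow_natCast, ← Real.rpow_natCast, ← Real.rpow_mul ht.le, Nat.cast_sub hd]
      congr 1
      push_cast; ring
    simp only [this]

theorem lintegral_beta {a b : ℝ} (ha : 0 < a) (hb : 0 < b) :
    ∫⁻ x in Set.Ioo (0 : ℝ) 1, ENNReal.ofReal (x ^ (a - 1) * (1 - x) ^ (b - 1)) =
      ENNReal.ofReal (Real.Gamma a * Real.Gamma b / Real.Gamma (a + b)) := by
  have h := ProbabilityTheory.lintegral_betaPDF_eq_one ha hb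
  have hB := ProbabilityTheory.beta_pos ha hb
  rw [ProbabilityTheory.lintegral_betaPDF] at h
  simp only [mul_assoc] at h
  simp only [ENNReal.ofReal_mul (one_div_pos.2 hB).le] at h
  rw [lintegral_const_mul _ (by fun_prop), one_div, ENNReal.ofReal_inv_of_pos hB] at h
  rw [mul_comm] at h
  rw [ENNReal.eq_inv_of_mul_eq_one_left h, inv_inv]
  rfl

theorem lintegral_ball_one_sub_sum_sq (m : ℕ) :
    ∫⁻ z : Fin m → ℝ, {s : ℝ | s < 1}.indicator
        (fun s => ENNReal.ofReal ((1 - s) ^ (-(1 / 2) : ℝ))) (∑ i, z i ^ 2) =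
      ENNReal.ofReal (π ^ (((m : ℝ) + 1) / 2) / Real.Gamma (((m : ℝ) + 1) / 2)) := by
  have hgm : Measurable ({s : ℝ | s < 1}.indicator
      (fun s => ENNReal.ofReal ((1 - s) ^ (-(1 / 2) : ℝ)))) :=
    Measurable.indicator (by fun_prop) measurableSet_Iio
  rcases Nat.eq_zero_or_pos m with rfl | hm
  · have : √π ≠ 0 := by positivity
    simp only [Finset.univ_eq_empty, Finset.sum_empty, lintegral_const]
    rw [Nat.cast_zero, zero_add, Real.Gamma_one_half_eq, ← Real.sqrt_eq_rpow, div_self this]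
    simp [volume_pi]
  · have hm0 : (0 : ℝ) < m := by exact_mod_cast hm
    rw [lintegral_comp_sum_sq hm hgm]
    have h1 := map_sq_volume
    have h2 := congrArg (fun μ => ∫⁻ p, ENNReal.ofReal (p ^ (((m : ℝ) - 1) / 2)) *
      {s : ℝ | s < 1}.indicator (fun s => ENNReal.ofReal ((1 - s) ^ (-(1 / 2) : ℝ))) p ∂μ) h1
    have hm1 : Measurable fun p : ℝ => ENNReal.ofReal (p ^ (-(1 / 2) : ℝ)) := by fun_prop
    rw [lintegral_map (by fun_prop) (by fun_prop),
      lintegral_withDensity_eq_lintegral_mul _ measurable_const (by fun_prop),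
      lintegral_withDensity_eq_lintegral_mul _ (hm1.indicator measurableSet_Ioi)
        (by fun_prop)] at h2
    simp only [Pi.mul_apply, one_mul] at h2
    rw [h2]
    have h3 : ∀ p : ℝ, (Set.Ioi 0).indicator (fun p => ENNReal.ofReal (p ^ (-(1 / 2) : ℝ))) p *
        (ENNReal.ofReal (p ^ (((m : ℝ) - 1) / 2)) *
        {s : ℝ | s < 1}.indicator (fun s => ENNReal.ofReal ((1 - s) ^ (-(1 / 2) : ℝ))) p) =
        (Set.Ioo (0 : ℝ) 1).indicator (fun x =>
          ENNReal.ofReal (x ^ ((m : ℝ) / 2 - 1) * (1 - x) ^ ((1 / 2 : ℝ) - 1))) p := by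
      intro p
      by_cases hp : 0 < p
      · by_cases hp1 : p < 1
        · rw [Set.indicator_of_mem (show p ∈ Set.Ioi (0 : ℝ) from hp),
            Set.indicator_of_mem (show p ∈ {s : ℝ | s < 1} from hp1),
            Set.indicator_of_mem (show p ∈ Set.Ioo (0 : ℝ) 1 from ⟨hp, hp1⟩),
            ← mul_assoc, ← ENNReal.ofReal_mul (by positivity), ← ENNReal.ofReal_mul (by positivity),
            ← Real.rpow_add hp]
          congr 3 <;> ring_nf
        · rw [Set.indicator_of_notMem (show p ∉ {s : ℝ | s < 1} from hp1),
            Set.indicator_of_notMem (show p ∉ Set.Ioo (0 : ℝ) 1 from fun h => hp1 h.2)]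
          simp
      · rw [Set.indicator_of_notMem (show p ∉ Set.Ioi (0 : ℝ) from hp),
            Set.indicator_of_notMem (show p ∉ Set.Ioo (0 : ℝ) 1 from fun h => hp h.1)]
        simp
    simp only [h3]
    rw [lintegral_indicator measurableSet_Ioo, lintegral_beta (half_pos hm0) (by norm_num),
      Real.Gamma_one_half_eq, ← ENNReal.ofReal_mul]
    · congr 1
      have hG := (Real.Gamma_pos_of_pos (half_pos hm0)).ne'
      rw [Real.sqrt_eq_rpow, add_div, Real.rpow_add pi_pos]
      field_simp
    · have hG := (Real.Gamma_pos_of_pos (half_pos hm0))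
      positivity

/-- The absolute value of the Vandermonde determinant. -/
noncomputable def absVandermonde {m : ℕ} (x : Fin m → ℝ) : ℝ := |(vandermonde x).det|

theorem absVandermonde_eq {m : ℕ} (x : Fin m → ℝ) :
    absVandermonde x = ∏ i, ∏ j ∈ Finset.Ioi i, |x i - x j| := by
  simp only [absVandermonde, det_vandermonde, Finset.abs_prod]
  exact Finset.prod_congr rfl fun i _ => Finset.prod_congr rfl fun j _ => abs_sub_comm _ _

theorem absVandermonde_of_strictAnti {m : ℕ} {x : Fin m → ℝ} (hx : StrictAnti x) :
    absVandermonde x = ∏ i, ∏ j ∈ Finset.Ioi i, (x i - x j) := by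
  rw [absVandermonde_eq]
  exact Finset.prod_congr rfl fun i _ => Finset.prod_congr rfl fun j hj =>
    abs_of_pos (sub_pos.2 (hx (Finset.mem_Ioi.1 hj)))

theorem absVandermonde_nonneg {m : ℕ} (x : Fin m → ℝ) : 0 ≤ absVandermonde x := abs_nonneg _

theorem absVandermonde_pos {m : ℕ} {x : Fin m → ℝ} (hx : Function.Injective x) :
    0 < absVandermonde x := by
  rw [absVandermonde_eq]
  exact Finset.prod_pos fun i _ => Finset.prod_pos fun j hj =>
    abs_pos.2 (sub_ne_zero.2 (hx.ne (Finset.mem_Ioi.1 hj).ne))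

theorem measurable_absVandermonde {m : ℕ} :
    Measurable (absVandermonde : (Fin m → ℝ) → ℝ) := by
  have : (absVandermonde : (Fin m → ℝ) → ℝ) =
      fun x => ∏ i, ∏ j ∈ Finset.Ioi i, |x i - x j| := funext absVandermonde_eq
  rw [this]
  fun_prop

theorem prod_prod_erase_abs_sub {m : ℕ} (x : Fin m → ℝ) :
    ∏ i, ∏ j ∈ Finset.univ.erase i, |x i - x j| = absVandermonde x ^ 2 := by
  have h : ∀ i : Fin m, Finset.univ.erase i = Finset.Ioi i ∪ Finset.Iio i := by
    intro i; ext j; simp [lt_or_lt_iff_ne, eq_comm]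
  have hd : ∀ i : Fin m, Disjoint (Finset.Ioi i) (Finset.Iio i) := by
    intro i
    rw [Finset.disjoint_left]
    intro j h1 h2
    exact lt_asymm (Finset.mem_Ioi.1 h1) (Finset.mem_Iio.1 h2)
  have h2 : ∏ i, ∏ j ∈ Finset.Iio i, |x i - x j| = ∏ i, ∏ j ∈ Finset.Ioi i, |x i - x j| := by
    rw [Finset.prod_comm' (t' := Finset.univ) (s' := fun j => Finset.Ioi j) (by simp)]
    exact Finset.prod_congr rfl fun i _ => Finset.prod_congr rfl fun j _ => abs_sub_comm _ _
  simp only [h, Finset.prod_union (hd _), Finset.prod_mul_distrib, h2, absVandermonde_eq, sq]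

/-- The vectors `l` strictly interlacing `c` from above: `l₀ > c₀ > l₁ > c₁ > ⋯`. -/
def interlacing {m : ℕ} (c : Fin m → ℝ) : Set (Fin m → ℝ) :=
  {l | ∀ i j, (j ≤ i → c i < l j) ∧ (i < j → l j < c i)}

theorem measurableSet_interlacing {m : ℕ} (c : Fin m → ℝ) : MeasurableSet (interlacing c) := by
  have : interlacing c = ⋂ i, ⋂ j, {l | (j ≤ i → c i < l j) ∧ (i < j → l j < c i)} := by
    ext; simp [interlacing]
  rw [this]
  refine MeasurableSet.iInter fun i => MeasurableSet.iInter fun j => ?_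
  rcases le_or_gt j i with h | h
  · simpa [h, h.not_gt] using measurableSet_lt measurable_const (measurable_pi_apply j)
  · simpa [h, h.not_ge] using measurableSet_lt (measurable_pi_apply j) measurable_const

/-- The weights `p` in `∏ (t - l_j) / ∏ (t - c_i) = 1 - ∑ p_i / (t - c_i)`. -/
noncomputable def residues {m : ℕ} (c l : Fin m → ℝ) (i : Fin m) : ℝ :=
  -(∏ j, (c i - l j)) / ∏ j ∈ Finset.univ.erase i, (c i - c j)

theorem neg_one_pow_mul_prod_erase_sub {m : ℕ} {c : Fin m → ℝ} (hc : StrictAnti c) (i : Fin m) :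
    ∏ j ∈ Finset.univ.erase i, (c i - c j) =
      (-1) ^ (i : ℕ) * ∏ j ∈ Finset.univ.erase i, |c i - c j| := by
  have h1 : ∀ j ∈ Finset.univ.erase i, c i - c j = (if j < i then -1 else 1) * |c i - c j| := by
    intro j hj
    split_ifs with h
    · rw [abs_of_neg (sub_neg.2 (hc h))]; ring
    · rw [abs_of_pos (sub_pos.2 (hc (lt_of_le_of_ne (not_lt.1 h) (Finset.ne_of_mem_erase hj).symm)))]
      ring
  rw [Finset.prod_congr rfl h1, Finset.prod_mul_distrib, Finset.prod_ite, Finset.prod_const,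
    Finset.prod_const_one, mul_one]
  congr 2
  have : (Finset.univ.erase i).filter (· < i) = Finset.Iio i := by
    ext j
    simp only [Finset.mem_filter, Finset.mem_erase, Finset.mem_univ, Finset.mem_Iio]
    exact ⟨fun h => h.2, fun h => ⟨⟨h.ne, trivial⟩, h⟩⟩
  rw [this, Fin.card_Iio]

theorem neg_one_pow_mul_prod_sub {m : ℕ} {c l : Fin m → ℝ} (hl : l ∈ interlacing c) (i : Fin m) :
    ∏ j, (c i - l j) = (-1) ^ ((i : ℕ) + 1) * ∏ j, |c i - l j| := by
  have h1 : ∀ j, c i - l j = (if j ≤ i then -1 else 1) * |c i - l j| := by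
    intro j
    split_ifs with h
    · rw [abs_of_neg (sub_neg.2 ((hl i j).1 h))]; ring
    · rw [abs_of_pos (sub_pos.2 ((hl i j).2 (not_le.1 h)))]; ring
  rw [Finset.prod_congr rfl fun j _ => h1 j, Finset.prod_mul_distrib, Finset.prod_ite,
    Finset.prod_const, Finset.prod_const_one, mul_one]
  congr 2
  have : Finset.univ.filter (· ≤ i) = Finset.Iic i := by ext j; simp
  rw [this, Fin.card_Iic]

theorem residues_eq_abs {m : ℕ} {c l : Fin m → ℝ} (hc : StrictAnti c) (hl : l ∈ interlacing c)
    (i : Fin m) :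
    residues c l i = (∏ j, |c i - l j|) / ∏ j ∈ Finset.univ.erase i, |c i - c j| := by
  rw [residues, neg_one_pow_mul_prod_erase_sub hc, neg_one_pow_mul_prod_sub hl, pow_succ]
  have : ((-1 : ℝ)) ^ (i : ℕ) ≠ 0 := by positivity
  rw [mul_neg_one, neg_mul, neg_neg, mul_div_mul_left _ _ this]

theorem abs_sub_pos_of_interlacing {m : ℕ} {c l : Fin m → ℝ} (hl : l ∈ interlacing c)
    (i j : Fin m) : 0 < |c i - l j| := by
  refine abs_pos.2 (sub_ne_zero.2 ?_)
  rcases le_or_gt j i with h | h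
  · exact ((hl i j).1 h).ne
  · exact ((hl i j).2 h).ne'

theorem prod_erase_abs_sub_pos {m : ℕ} {c : Fin m → ℝ} (hc : Function.Injective c) (i : Fin m) :
    0 < ∏ j ∈ Finset.univ.erase i, |c i - c j| :=
  Finset.prod_pos fun _ hj => abs_pos.2 (sub_ne_zero.2 (hc.ne (Finset.ne_of_mem_erase hj).symm))

theorem residues_pos {m : ℕ} {c l : Fin m → ℝ} (hc : StrictAnti c) (hl : l ∈ interlacing c)
    (i : Fin m) : 0 < residues c l i := by
  rw [residues_eq_abs hc hl]
  exact div_pos (Finset.prod_pos fun j _ => abs_sub_pos_of_interlacing hl i j)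
    (prod_erase_abs_sub_pos hc.injective i)

theorem prod_residues {m : ℕ} {c l : Fin m → ℝ} (hc : StrictAnti c) (hl : l ∈ interlacing c) :
    ∏ i, residues c l i = (∏ i, ∏ j, |c i - l j|) / absVandermonde c ^ 2 := by
  simp only [residues_eq_abs hc hl, Finset.prod_div_distrib, prod_prod_erase_abs_sub]

theorem strictAnti_of_interlacing {m : ℕ} {c l : Fin m → ℝ} (hl : l ∈ interlacing c) :
    StrictAnti l := fun i j hij => ((hl i j).2 hij).trans ((hl i i).1 le_rfl)

open Polynomial in
theorem degree_sum_C_mul_prod_erase_lt {m : ℕ} (c p : Fin m → ℝ) :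
    (∑ i, C (p i) * ∏ j ∈ Finset.univ.erase i, (X - C (c j))).degree < m := by
  refine (degree_sum_le _ _).trans_lt ((Finset.sup_lt_iff (WithBot.bot_lt_coe m)).2 ?_)
  intro i _
  rw [← smul_eq_C_mul]
  refine (degree_smul_le _ _).trans_lt ?_
  rw [degree_prod_of_monic _ _ fun i _ => monic_X_sub_C _]
  simp only [degree_X_sub_C, Finset.sum_const, nsmul_eq_mul, mul_one,
    Finset.card_erase_of_mem (Finset.mem_univ i), Finset.card_univ, Fintype.card_fin]
  exact WithBot.coe_lt_coe.2 (Nat.sub_lt i.pos one_pos)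

open Polynomial in
theorem monic_univ_prod_X_sub_C {m : ℕ} (c : Fin m → ℝ) : (∏ i, (X - C (c i))).Monic :=
  monic_prod_of_monic _ _ fun _ _ => monic_X_sub_C _

open Polynomial in
theorem natDegree_prod_X_sub_C {m : ℕ} (c : Fin m → ℝ) :
    (∏ i, (X - C (c i))).natDegree = m := by
  rw [natDegree_prod_of_monic _ _ fun _ _ => monic_X_sub_C _]; simp

open Polynomial in
theorem degree_sub_lt_of_monic {m : ℕ} {P Q : ℝ[X]} (hP : P.Monic) (hQ : Q.Monic)
    (hPd : P.natDegree = m) (hQd : Q.natDegree = m) : (P - Q).degree < m := by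
  rcases eq_or_ne P Q with he | hne
  · rw [he, sub_self, degree_zero]; exact WithBot.bot_lt_coe m
  · have := degree_sub_lt_left (p := P) (q := Q) (by
      rw [degree_eq_natDegree hP.ne_zero, degree_eq_natDegree hQ.ne_zero, hPd, hQd])
      hP.ne_zero (by rw [hP, hQ])
    rwa [degree_eq_natDegree hP.ne_zero, hPd] at this

open Polynomial in
theorem eval_sum_C_mul_prod_erase {m : ℕ} (c p : Fin m → ℝ) (i : Fin m) :
    (∑ i, C (p i) * ∏ j ∈ Finset.univ.erase i, (X - C (c j))).eval (c i) =
      p i * ∏ j ∈ Finset.univ.erase i, (c i - c j) := by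
  rw [eval_finsetSum, Finset.sum_eq_single i, eval_mul, eval_prod]
  · simp
  · intro k _ hk
    rw [eval_mul, eval_prod, Finset.prod_eq_zero
      (Finset.mem_erase.2 ⟨hk.symm, Finset.mem_univ i⟩) (by simp), mul_zero]
  · simp

open Polynomial in
/-- A monic polynomial of degree `m` is determined by its values at `m` points. -/
theorem prod_sub_eq_of_eval {m : ℕ} {c : Fin m → ℝ} (hc : Function.Injective c) {P : ℝ[X]}
    (hP : P.Monic) (hdeg : P.natDegree = m) {p : Fin m → ℝ}
    (h : ∀ i, P.eval (c i) = -(p i * ∏ j ∈ Finset.univ.erase i, (c i - c j))) :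
    P = ∏ i, (X - C (c i)) - ∑ i, C (p i) * ∏ j ∈ Finset.univ.erase i, (X - C (c j)) := by
  rw [eq_sub_iff_add_eq, ← eq_sub_iff_add_eq', ← neg_sub P, eq_neg_iff_add_eq_zero]
  refine Polynomial.eq_zero_of_degree_lt_of_eval_index_eq_zero (v := c) Finset.univ
    hc.injOn ?_ ?_
  · rw [Finset.card_univ, Fintype.card_fin]
    exact (degree_add_le _ _).trans_lt (max_lt (degree_sum_C_mul_prod_erase_lt c p)
      (degree_sub_lt_of_monic hP (monic_univ_prod_X_sub_C c) hdeg (natDegree_prod_X_sub_C c)))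
  · intro i _
    rw [eval_add, eval_sub, h i, eval_sum_C_mul_prod_erase, eval_prod,
      Finset.prod_eq_zero (Finset.mem_univ i) (by simp)]
    ring

open Polynomial in
theorem prod_X_sub_C_eq_residues {m : ℕ} {c : Fin m → ℝ} (hc : Function.Injective c)
    (l : Fin m → ℝ) :
    ∏ j, (X - C (l j)) = ∏ i, (X - C (c i)) -
      ∑ i, C (residues c l i) * ∏ j ∈ Finset.univ.erase i, (X - C (c j)) := by
  refine prod_sub_eq_of_eval hc (monic_univ_prod_X_sub_C l) (natDegree_prod_X_sub_C l) ?_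
  · intro i
    have : ∏ j ∈ Finset.univ.erase i, (c i - c j) ≠ 0 := Finset.prod_ne_zero_iff.2 fun j hj =>
      sub_ne_zero.2 (hc.ne (Finset.ne_of_mem_erase hj).symm)
    rw [residues, div_mul_cancel₀ _ this, neg_neg, eval_prod]
    simp

theorem injOn_residues {m : ℕ} {c : Fin m → ℝ} (hc : Function.Injective c) :
    Set.InjOn (residues c) (interlacing c) := by
  intro l hl l' hl' h
  have h1 := prod_X_sub_C_eq_residues hc l
  rw [h, ← prod_X_sub_C_eq_residues hc l'] at h1
  funext j
  have h2 := congrArg (Polynomial.eval (l j)) h1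
  rw [Polynomial.eval_prod, Finset.prod_eq_zero (Finset.mem_univ j) (by simp),
    Polynomial.eval_prod, eq_comm, Finset.prod_eq_zero_iff] at h2
  obtain ⟨k, -, hk⟩ := h2
  simp only [Polynomial.eval_sub, Polynomial.eval_X, Polynomial.eval_C, sub_eq_zero] at hk
  rcases lt_trichotomy j k with hjk | hjk | hjk
  · exact absurd hk (((hl' j k).2 hjk).trans ((hl j j).1 le_rfl)).ne'
  · rw [hk, hjk]
  · exact absurd hk (((hl k j).2 hjk).trans ((hl' k k).1 le_rfl)).ne

/-- The rational function `1 - ∑ p_i / (t - c_i)` multiplied by `∏ (t - c_i)`. -/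
theorem eval_secular {m : ℕ} (c p : Fin m → ℝ) (t : ℝ) (ht : ∀ i, t ≠ c i) :
    ∏ i, (t - c i) - ∑ i, p i * ∏ j ∈ Finset.univ.erase i, (t - c j) =
      (∏ i, (t - c i)) * (1 - ∑ i, p i / (t - c i)) := by
  rw [mul_sub, mul_one, Finset.mul_sum]
  congr 1
  refine Finset.sum_congr rfl fun i _ => ?_
  rw [← Finset.mul_prod_erase _ _ (Finset.mem_univ i)]
  have := sub_ne_zero.2 (ht i)
  field_simp

open Polynomial in
theorem exists_residues_eq {m : ℕ} {c p : Fin m → ℝ} (hc : StrictAnti c) (hp : ∀ i, 0 < p i) :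
    ∃ l ∈ interlacing c, residues c l = p := by
  set Q : ℝ[X] := ∑ i, C (p i) * ∏ j ∈ Finset.univ.erase i, (X - C (c j)) with hQ
  set R : ℝ[X] := ∏ i, (X - C (c i)) - Q with hR
  have hRc : ∀ i, R.eval (c i) =
      (-1) ^ ((i : ℕ) + 1) * (p i * ∏ j ∈ Finset.univ.erase i, |c i - c j|) := by
    intro i
    rw [hR, eval_sub, hQ, eval_sum_C_mul_prod_erase, eval_prod,
      Finset.prod_eq_zero (Finset.mem_univ i) (by simp), neg_one_pow_mul_prod_erase_sub hc]
    ring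
  have hpos : ∀ i, 0 < p i * ∏ j ∈ Finset.univ.erase i, |c i - c j| := fun i =>
    mul_pos (hp i) (prod_erase_abs_sub_pos hc.injective i)
  have hroot : ∀ j : Fin m, ∃ x, R.eval x = 0 ∧ c j < x ∧ ∀ i, i < j → x < c i := by
    rintro ⟨j, hj⟩
    rcases j with _ | j
    · set s := c ⟨0, hj⟩ + ∑ i, p i + 1 with hs
      have hS : 0 ≤ ∑ i, p i := Finset.sum_nonneg fun i _ => (hp i).le
      have hci : ∀ i, c i ≤ c ⟨0, hj⟩ := fun i => hc.antitone (Fin.mk_le_of_le_val (Nat.zero_le _))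
      have h1 : R.eval (c ⟨0, hj⟩) < 0 := by
        rw [hRc]; simpa using hpos ⟨0, hj⟩
      have h2 : 0 < R.eval s := by
        have : R.eval s = ∏ i, (s - c i) - ∑ i, p i * ∏ j ∈ Finset.univ.erase i, (s - c j) := by
          rw [hR, hQ, eval_sub, eval_prod, eval_finsetSum]
          simp [eval_prod]
        rw [this, eval_secular _ _ _ fun i => by have := hci i; intro h; linarith]
        refine mul_pos (Finset.prod_pos fun i _ => by have := hci i; linarith) ?_
        have : ∑ i, p i / (s - c i) ≤ ∑ i, p i / (∑ i, p i + 1) :=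
          Finset.sum_le_sum fun i _ => div_le_div_of_nonneg_left (hp i).le (by linarith)
            (by have := hci i; linarith)
        rw [← Finset.sum_div] at this
        have h3 : (∑ i, p i) / (∑ i, p i + 1) < 1 := (div_lt_one (by linarith)).2 (by linarith)
        linarith
      obtain ⟨x, hx, hx0⟩ := intermediate_value_Ioo (by linarith : c ⟨0, hj⟩ ≤ s)
        R.continuous.continuousOn ⟨h1, h2⟩
      exact ⟨x, hx0, hx.1, fun i hi => absurd hi (by simp [Fin.lt_def])⟩
    · have hj' : j < m := Nat.lt_of_succ_lt hj
      have hlt : c ⟨j + 1, hj⟩ < c ⟨j, hj'⟩ := hc (Fin.mk_lt_mk.2 (Nat.lt_succ_self j))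
      have h1 := hRc ⟨j + 1, hj⟩
      have h2 := hRc ⟨j, hj'⟩
      have p1 := hpos ⟨j + 1, hj⟩
      have p2 := hpos ⟨j, hj'⟩
      have h0 : (0 : ℝ) ∈ (fun x => R.eval x) '' Set.Ioo (c ⟨j + 1, hj⟩) (c ⟨j, hj'⟩) := by
        rcases neg_one_pow_eq_or ℝ j with hs | hs
        · refine intermediate_value_Ioo' hlt.le R.continuous.continuousOn ⟨?_, ?_⟩
          · rw [h2, pow_succ, hs]; linarith
          · rw [h1, pow_succ, pow_succ, hs]; linarith
        · refine intermediate_value_Ioo hlt.le R.continuous.continuousOn ⟨?_, ?_⟩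
          · rw [h1, pow_succ, pow_succ, hs]; linarith
          · rw [h2, pow_succ, hs]; linarith
      obtain ⟨x, hx, hx0⟩ := h0
      refine ⟨x, hx0, hx.1, fun i hi => hx.2.trans_le (hc.antitone ?_)⟩
      rw [Fin.le_def]
      have := Fin.lt_def.1 hi
      simp only at this ⊢
      omega
  choose l hl0 hl1 hl2 using hroot
  have hl : l ∈ interlacing c := fun i j =>
    ⟨fun h => (hc.antitone h).trans_lt (hl1 j), fun h => hl2 j i h⟩
  refine ⟨l, hl, ?_⟩
  have hRl : R = ∏ j, (X - C (l j)) := by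
    rw [← sub_eq_zero]
    refine Polynomial.eq_zero_of_degree_lt_of_eval_index_eq_zero (v := l) Finset.univ
      (strictAnti_of_interlacing hl).injective.injOn ?_ ?_
    · rw [Finset.card_univ, Fintype.card_fin, hR, sub_right_comm]
      refine (degree_sub_le _ _).trans_lt (max_lt ?_ (degree_sum_C_mul_prod_erase_lt c p))
      exact degree_sub_lt_of_monic (monic_univ_prod_X_sub_C c) (monic_univ_prod_X_sub_C l)
        (natDegree_prod_X_sub_C c) (natDegree_prod_X_sub_C l)
    · intro j _
      rw [eval_sub, hl0, eval_prod, Finset.prod_eq_zero (Finset.mem_univ j) (by simp), sub_zero]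
  funext i
  have h := prod_X_sub_C_eq_residues hc.injective l
  rw [← hRl, hR, sub_right_inj] at h
  have h2 := congrArg (eval (c i)) h
  rw [hQ, eval_sum_C_mul_prod_erase, eval_sum_C_mul_prod_erase] at h2
  have : ∏ j ∈ Finset.univ.erase i, (c i - c j) ≠ 0 := Finset.prod_ne_zero_iff.2 fun j hj =>
    sub_ne_zero.2 (hc.injective.ne (Finset.ne_of_mem_erase hj).symm)
  exact (mul_right_cancel₀ this h2).symm

theorem image_residues {m : ℕ} {c : Fin m → ℝ} (hc : StrictAnti c) :
    residues c '' interlacing c = {p | ∀ i, 0 < p i} := by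
  ext p
  constructor
  · rintro ⟨l, hl, rfl⟩ i
    exact residues_pos hc hl i
  · intro hp
    exact exists_residues_eq hc hp

/-- The matrix of partial derivatives of `l ↦ ∏ (c_i - l_j)`, up to sign. -/
noncomputable def prodEraseMatrix {m : ℕ} (c l : Fin m → ℝ) : Matrix (Fin m) (Fin m) ℝ :=
  Matrix.of fun i j => ∏ k ∈ Finset.univ.erase j, (c i - l k)

open Polynomial in
theorem prodEraseMatrix_eq {m : ℕ} (c l : Fin m → ℝ) :
    prodEraseMatrix c l = vandermonde c * Matrix.of fun (r j : Fin m) =>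
      (∏ k ∈ Finset.univ.erase j, (X - C (l k))).coeff r := by
  ext i j
  rw [Matrix.mul_apply]
  simp only [prodEraseMatrix, Matrix.of_apply, vandermonde_apply]
  have hd : (∏ k ∈ Finset.univ.erase j, (X - C (l k))).natDegree < m := by
    rw [natDegree_prod_of_monic _ _ fun i _ => monic_X_sub_C _]
    simp only [natDegree_X_sub_C, Finset.sum_const, smul_eq_mul, mul_one,
      Finset.card_erase_of_mem (Finset.mem_univ j), Finset.card_univ, Fintype.card_fin]
    exact Nat.sub_lt j.pos one_pos
  have h := eval_eq_sum_range' hd (c i)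
  rw [eval_prod] at h
  simp only [eval_sub, eval_X, eval_C] at h
  rw [h, Finset.sum_range]
  exact Finset.sum_congr rfl fun _ _ => mul_comm _ _

theorem abs_det_prodEraseMatrix {m : ℕ} (c : Fin m → ℝ) {l : Fin m → ℝ}
    (hl : Function.Injective l) :
    |(prodEraseMatrix c l).det| = absVandermonde c * absVandermonde l := by
  have h1 : ∀ c : Fin m → ℝ, |(prodEraseMatrix c l).det| = absVandermonde c *
      |(Matrix.of fun (r j : Fin m) =>
        (∏ k ∈ Finset.univ.erase j, (Polynomial.X - Polynomial.C (l k))).coeff r).det| := by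
    intro c
    rw [prodEraseMatrix_eq, det_mul, abs_mul, absVandermonde]
  have h2 : prodEraseMatrix l l =
      diagonal fun j => ∏ k ∈ Finset.univ.erase j, (l j - l k) := by
    ext i j
    rcases eq_or_ne i j with rfl | h
    · simp [prodEraseMatrix]
    · rw [diagonal_apply_ne _ h]
      exact Finset.prod_eq_zero (Finset.mem_erase.2 ⟨h, Finset.mem_univ i⟩) (sub_self _)
  have h3 := h1 l
  rw [h2, det_diagonal, Finset.abs_prod] at h3
  simp only [Finset.abs_prod] at h3
  rw [prod_prod_erase_abs_sub, sq] at h3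
  rw [h1 c, ← mul_left_cancel₀ (absVandermonde_pos hl).ne' h3]

/-- The derivative of `residues c` as a matrix. -/
noncomputable def residuesDeriv {m : ℕ} (c l : Fin m → ℝ) : Matrix (Fin m) (Fin m) ℝ :=
  Matrix.of fun i j => (∏ j ∈ Finset.univ.erase i, (c i - c j))⁻¹ * prodEraseMatrix c l i j

theorem hasFDerivAt_residues {m : ℕ} (c l : Fin m → ℝ) :
    HasFDerivAt (residues c) (Matrix.toLin' (residuesDeriv c l)).toContinuousLinearMap l := by
  rw [hasFDerivAt_pi']
  intro i
  have h1 : ∀ j ∈ (Finset.univ : Finset (Fin m)), HasFDerivAt (fun l : Fin m → ℝ => c i - l j)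
      (-(ContinuousLinearMap.proj (R := ℝ) (φ := fun _ : Fin m => ℝ) j)) l := fun j _ =>
    (ContinuousLinearMap.proj (R := ℝ) (φ := fun _ : Fin m => ℝ) j).hasFDerivAt.const_sub _
  have h2 := (HasFDerivAt.finsetProd h1).neg.mul_const
    (∏ j ∈ Finset.univ.erase i, (c i - c j))⁻¹
  refine h2.congr_fderiv ?_
  ext v
  simp [residuesDeriv, prodEraseMatrix, Matrix.mulVec, dotProduct, Finset.mul_sum, mul_assoc,
    Finset.sum_neg_distrib]

theorem abs_det_residuesDeriv {m : ℕ} {c l : Fin m → ℝ} (hc : Function.Injective c)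
    (hl : Function.Injective l) :
    |(residuesDeriv c l).det| = absVandermonde l / absVandermonde c := by
  rw [residuesDeriv, det_mul_column, abs_mul, abs_det_prodEraseMatrix c hl, Finset.abs_prod]
  simp only [abs_inv, Finset.abs_prod]
  rw [Finset.prod_inv_distrib, prod_prod_erase_abs_sub]
  have := (absVandermonde_pos hc).ne'
  field_simp

theorem lintegral_pos_eq_interlacing {m : ℕ} {c : Fin m → ℝ} (hc : StrictAnti c)
    (f : (Fin m → ℝ) → ENNReal) :
    ∫⁻ p in {p | ∀ i, 0 < p i}, f p = ∫⁻ l in interlacing c,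
      ENNReal.ofReal (absVandermonde l / absVandermonde c) * f (residues c l) := by
  rw [← image_residues hc, lintegral_image_eq_lintegral_abs_det_fderiv_mul volume
    (measurableSet_interlacing c) (fun l _ => (hasFDerivAt_residues c l).hasFDerivWithinAt)
    (injOn_residues hc.injective)]
  refine setLIntegral_congr_fun (measurableSet_interlacing c) fun l hl => ?_
  simp only [ContinuousLinearMap.det, LinearMap.coe_toContinuousLinearMap, LinearMap.det_toLin',
    abs_det_residuesDeriv hc.injective (strictAnti_of_interlacing hl).injective]

theorem lintegral_comp_sq_interlacing {m : ℕ} {c : Fin m → ℝ} (hc : StrictAnti c)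
    {f : (Fin m → ℝ) → ENNReal} (hf : Measurable f) :
    ∫⁻ y : Fin m → ℝ, f (fun i => y i ^ 2) = ∫⁻ l in interlacing c,
      ENNReal.ofReal (absVandermonde l * ∏ i, ∏ j, |c i - l j| ^ (-(1 / 2) : ℝ)) *
        f (residues c l) := by
  rw [lintegral_comp_sq_pi hf, lintegral_pos_eq_interlacing hc]
  refine setLIntegral_congr_fun (measurableSet_interlacing c) fun l hl => ?_
  rw [← mul_assoc]
  congr 1
  have hr := fun i => (residues_pos hc hl i).le
  rw [← ENNReal.ofReal_prod_of_nonneg fun i _ => rpow_nonneg (hr i) _, ← ENNReal.ofReal_mul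
    (div_nonneg (absVandermonde_nonneg l) (absVandermonde_nonneg c)), Real.finsetProd_rpow _ _ fun i _ => hr i,
    prod_residues hc hl]
  congr 1
  have hV := absVandermonde_pos hc.injective
  have h0 : ∀ i, 0 ≤ ∏ j, |c i - l j| := fun i => Finset.prod_nonneg fun j _ => abs_nonneg _
  rw [Real.div_rpow (Finset.prod_nonneg fun i _ => h0 i) (sq_nonneg _), ← Real.rpow_natCast,
    ← Real.rpow_mul hV.le, ← Real.finsetProd_rpow _ _ fun i _ => h0 i]
  have h1 : ∀ i, ∏ j, |c i - l j| ^ (-(1 / 2) : ℝ) = (∏ j, |c i - l j|) ^ (-(1 / 2) : ℝ) :=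
    fun i => Real.finsetProd_rpow _ _ (fun j _ => abs_nonneg _) _
  simp only [h1]
  norm_num
  rw [Real.rpow_neg_one]
  field_simp

theorem lintegral_pi_scale {m : ℕ} {D : Fin m → ℝ} (hD : ∀ i, 0 < D i)
    {f : (Fin m → ℝ) → ENNReal} (hf : Measurable f) :
    ∫⁻ y, f y = ENNReal.ofReal (∏ i, D i) * ∫⁻ z : Fin m → ℝ, f (fun i => D i * z i) := by
  have hpos : 0 < ∏ i, D i := Finset.prod_pos fun i _ => hD i
  have h := Real.smul_map_diagonal_volume_pi (D := D) (by rw [det_diagonal]; exact hpos.ne')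
  conv_lhs => rw [← h]
  rw [lintegral_smul_measure, det_diagonal, abs_of_pos hpos, smul_eq_mul,
    lintegral_map hf (LinearMap.continuous_of_finiteDimensional _).measurable]
  congr 2
  funext z
  congr 1
  funext i
  simp [mulVec_diagonal]

/-- The vectors `b` with `l₀ > b₀ > l₁ > b₁ > ⋯ > l_m`. -/
def interlacingBelow {m : ℕ} (l : Fin (m + 1) → ℝ) : Set (Fin m → ℝ) :=
  {b | ∀ i j, (j ≤ Fin.castSucc i → b i < l j) ∧ (Fin.castSucc i < j → l j < b i)}

theorem mem_interlacingBelow_iff {m : ℕ} {l : Fin (m + 1) → ℝ} {b : Fin m → ℝ} :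
    b ∈ interlacingBelow l ↔ b ∈ interlacing (fun i : Fin m => l i.succ) ∧ ∀ j, b j < l 0 := by
  constructor
  · intro h
    exact ⟨fun i j => ⟨fun hij => (h j i.succ).2 (Fin.castSucc_lt_succ_iff.2 hij),
      fun hij => (h j i.succ).1 (Fin.succ_le_castSucc_iff.2 hij)⟩,
      fun j => (h j 0).1 (Fin.zero_le _)⟩
  · rintro ⟨h1, h2⟩ i j
    refine Fin.cases ?_ (fun j => ?_) j
    · exact ⟨fun _ => h2 i, fun h => absurd h (Fin.not_lt_zero _)⟩
    · exact ⟨fun h => (h1 j i).2 (Fin.succ_le_castSucc_iff.1 h),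
        fun h => (h1 j i).1 (Fin.castSucc_lt_succ_iff.1 h)⟩

theorem measurableSet_interlacingBelow {m : ℕ} (l : Fin (m + 1) → ℝ) :
    MeasurableSet (interlacingBelow l) := by
  have : interlacingBelow l = interlacing (fun i : Fin m => l i.succ) ∩ ⋂ j, {b | b j < l 0} := by
    ext b; simp [mem_interlacingBelow_iff]
  rw [this]
  exact (measurableSet_interlacing _).inter
    (MeasurableSet.iInter fun j => measurableSet_lt (measurable_pi_apply j) measurable_const)

theorem prod_sub_eq_secular {m : ℕ} {c : Fin m → ℝ} (hc : Function.Injective c)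
    (l : Fin m → ℝ) {t : ℝ} (ht : ∀ i, t ≠ c i) :
    ∏ j, (t - l j) = (∏ i, (t - c i)) * (1 - ∑ i, residues c l i / (t - c i)) := by
  rw [← eval_secular _ _ _ ht]
  have := congrArg (Polynomial.eval t) (prod_X_sub_C_eq_residues hc l)
  simpa [Polynomial.eval_prod, Polynomial.eval_finsetSum] using this

theorem forall_lt_iff_of_interlacing {m : ℕ} {c b : Fin m → ℝ} (hb : b ∈ interlacing c) {t : ℝ}
    (ht : ∀ i, c i < t) : (∀ j, b j < t) ↔ 0 < ∏ j, (t - b j) := by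
  constructor
  · intro h
    exact Finset.prod_pos fun j _ => sub_pos.2 (h j)
  · intro h
    by_contra! hcon
    obtain ⟨j, hj⟩ := hcon
    refine h.not_ge ?_
    rw [← Finset.mul_prod_erase _ _ (Finset.mem_univ j)]
    refine mul_nonpos_of_nonpos_of_nonneg (sub_nonpos.2 hj) (Finset.prod_nonneg fun i hi => ?_)
    rcases lt_or_gt_of_ne (Finset.ne_of_mem_erase hi) with hij | hij
    · exact absurd (((hb i j).2 hij).trans (ht i)) hj.not_gt
    · exact sub_nonneg.2 (((hb j i).2 hij).trans (ht j)).le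

theorem lintegral_interlacingBelow {m : ℕ} {l : Fin (m + 1) → ℝ} (hl : StrictAnti l) :
    ∫⁻ b in interlacingBelow l,
      ENNReal.ofReal (absVandermonde b * ∏ i, ∏ j, |b i - l j| ^ (-(1 / 2) : ℝ)) =
    ENNReal.ofReal (π ^ (((m : ℝ) + 1) / 2) / Real.Gamma (((m : ℝ) + 1) / 2)) := by
  set c : Fin m → ℝ := fun i => l i.succ with hcdef
  have hc : StrictAnti c := fun i j h => hl (Fin.succ_lt_succ_iff.2 h)
  have ht : ∀ i, c i < l 0 := fun i => hl (Fin.succ_pos i)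
  set w : Fin m → ℝ := fun i => l 0 - c i with hwdef
  have hw : ∀ i, 0 < w i := fun i => sub_pos.2 (ht i)
  have hW : 0 < ∏ i, w i := Finset.prod_pos fun i _ => hw i
  set g : ℝ → ENNReal :=
    {s : ℝ | s < 1}.indicator (fun s => ENNReal.ofReal ((1 - s) ^ (-(1/2):ℝ))) with hg
  have hgm : Measurable g := Measurable.indicator (by fun_prop) measurableSet_Iio
  set f : (Fin m → ℝ) → ENNReal := fun p =>
    ENNReal.ofReal ((∏ i, w i) ^ (-(1/2):ℝ)) * g (∑ i, p i / w i) with hf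
  have hfm : Measurable f := by
    refine Measurable.const_mul (hgm.comp ?_) _
    fun_prop
  have h1 : ∫⁻ y : Fin m → ℝ, f (fun i => y i ^ 2) =
      ENNReal.ofReal (π ^ (((m : ℝ) + 1) / 2) / Real.Gamma (((m : ℝ) + 1) / 2)) := by
    rw [lintegral_pi_scale (D := fun i => √(w i)) (fun i => Real.sqrt_pos.2 (hw i))
      (f := fun y => f (fun i => y i ^ 2)) (hfm.comp (by fun_prop)),
      ← lintegral_ball_one_sub_sum_sq m]
    have : ∀ z : Fin m → ℝ, f (fun i => (√(w i) * z i) ^ 2) =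
        ENNReal.ofReal ((∏ i, w i) ^ (-(1/2):ℝ)) * g (∑ i, z i ^ 2) := by
      intro z
      simp only [hf]
      congr 3
      funext i
      rw [mul_pow, Real.sq_sqrt (hw i).le]
      have := (hw i).ne'
      field_simp
    simp only [this]
    have hgz : Measurable fun z : Fin m → ℝ => g (∑ i, z i ^ 2) := hgm.comp (by fun_prop)
    rw [lintegral_const_mul _ hgz, ← mul_assoc, ← ENNReal.ofReal_mul
      (Finset.prod_nonneg fun i _ => Real.sqrt_nonneg _)]
    have h2 : (∏ i, √(w i)) * (∏ i, w i) ^ (-(1/2):ℝ) = 1 := by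
      simp only [Real.sqrt_eq_rpow]
      rw [Real.finsetProd_rpow _ _ fun i _ => (hw i).le, ← Real.rpow_add hW]
      norm_num
    rw [h2, ENNReal.ofReal_one, one_mul]
  rw [← h1, lintegral_comp_sq_interlacing hc hfm]
  have h3 : interlacingBelow l = interlacing c ∩ {b | ∀ j, b j < l 0} := by
    ext b; exact mem_interlacingBelow_iff
  rw [← lintegral_indicator (measurableSet_interlacingBelow l),
    ← lintegral_indicator (measurableSet_interlacing c)]
  refine lintegral_congr fun b => ?_
  by_cases hb : b ∈ interlacing c
  swap
  · rw [Set.indicator_of_notMem hb, Set.indicator_of_notMem]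
    rw [h3]; exact fun h => hb h.1
  rw [Set.indicator_of_mem hb]
  have hid := prod_sub_eq_secular hc.injective b (t := l 0) fun i => (ht i).ne'
  have hiff := forall_lt_iff_of_interlacing hb ht
  rw [hid, mul_pos_iff_of_pos_left hW, sub_pos] at hiff
  by_cases hlt : ∀ j, b j < l 0
  · rw [Set.indicator_of_mem (by rw [h3]; exact ⟨hb, hlt⟩)]
    have hs := hiff.1 hlt
    simp only [hf, hg]
    rw [Set.indicator_of_mem (by exact hs), ← ENNReal.ofReal_mul (by positivity),
      ← ENNReal.ofReal_mul (mul_nonneg (absVandermonde_nonneg b) (by positivity)), mul_assoc]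
    congr 2
    rw [← Real.mul_rpow hW.le (sub_pos.2 hs).le, ← hid, ← Real.finsetProd_rpow _ _
      fun j _ => (sub_pos.2 (hlt j)).le]
    simp only [Fin.prod_univ_succ, Finset.prod_mul_distrib]
    rw [mul_comm, Finset.prod_comm]
    congr 1
    · exact Finset.prod_congr rfl fun i _ => Finset.prod_congr rfl fun j _ => by
        rw [abs_sub_comm]
    · exact Finset.prod_congr rfl fun i _ => by
        rw [abs_sub_comm, abs_of_pos (sub_pos.2 (hlt i))]
  · rw [Set.indicator_of_notMem (by rw [h3]; exact fun h => hlt h.2)]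
    simp only [hf, hg]
    rw [Set.indicator_of_notMem (by exact fun h => hlt (hiff.2 h))]
    simp

open Polynomial in
theorem exists_equiv_of_prod_X_sub_C_eq {α β : Type*} [Fintype α] [Fintype β] {f : α → ℝ}
    {g : β → ℝ} (h : ∏ a, (X - C (f a)) = ∏ b, (X - C (g b))) :
    ∃ σ : α ≃ β, ∀ a, g (σ a) = f a := by
  classical
  have h2 : Finset.univ.val.map f = Finset.univ.val.map g := by
    have h3 := congrArg Polynomial.roots h
    rw [← roots_multiset_prod_X_sub_C (Finset.univ.val.map f),
      ← roots_multiset_prod_X_sub_C (Finset.univ.val.map g), Multiset.map_map, Multiset.map_map]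
    exact h3
  have hcard : ∀ r, Fintype.card {a // f a = r} = Fintype.card {b // g b = r} := by
    intro r
    have h3 := congrArg (Multiset.count r) h2
    rw [Multiset.count_map, Multiset.count_map] at h3
    rw [Fintype.card_subtype, Fintype.card_subtype, Finset.card_def, Finset.card_def,
      Finset.filter_val, Finset.filter_val]
    simpa only [eq_comm] using h3
  exact ⟨Equiv.ofFiberEquiv fun r => Fintype.equivOfCardEq (hcard r),
    fun a => Equiv.ofFiberEquiv_map _ a⟩

open Polynomial in
theorem eq_of_antitone_of_prod_X_sub_C_eq {m : ℕ} {f g : Fin m → ℝ} (hf : Antitone f)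
    (hg : Antitone g) (h : ∏ a, (X - C (f a)) = ∏ b, (X - C (g b))) : f = g := by
  obtain ⟨σ, hσ⟩ := exists_equiv_of_prod_X_sub_C_eq h
  have hfg : f = g ∘ σ := funext fun a => (hσ a).symm
  have := Tuple.unique_monotone (f := OrderDual.toDual ∘ g) (σ := σ) (τ := 1)
    (by rw [Function.comp_assoc, ← hfg]; exact hf.dual_right) hg.dual_right
  rw [hfg]
  exact this

theorem antitone_sortedEigs {n m : ℕ} (X : Matrix (Fin n) (Fin m) ℝ) :
    Antitone (sortedEigs X) := fun _ _ h =>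
  Tuple.monotone_sort _ (Fin.rev_le_rev.2 h)

theorem sortedEigs_nonneg {n m : ℕ} (X : Matrix (Fin n) (Fin m) ℝ) (i : Fin m) :
    0 ≤ sortedEigs X i :=
  (posSemidef_conjTranspose_mul_self X).eigenvalues_nonneg _

open Polynomial in
theorem charpoly_transpose_mul_self {n m : ℕ} (X' : Matrix (Fin n) (Fin m) ℝ) :
    (X'ᵀ * X').charpoly = ∏ i, (X - C (sortedEigs X' i)) := by
  have h := (isHermitian_conjTranspose_mul_self X').charpoly_eq
  refine Eq.trans (by rw [conjTranspose_eq_transpose_of_trivial]) (h.trans ?_)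
  exact (Fintype.prod_equiv (Fin.revPerm.trans
    (Tuple.sort (isHermitian_conjTranspose_mul_self X').eigenvalues)) _ _ fun _ => rfl).symm

open Polynomial in
theorem sortedEigs_eq_of_charpoly {n m : ℕ} {X' : Matrix (Fin n) (Fin m) ℝ} {l : Fin m → ℝ}
    (hl : Antitone l) (h : (X'ᵀ * X').charpoly = ∏ i, (X - C (l i))) : sortedEigs X' = l :=
  eq_of_antitone_of_prod_X_sub_C_eq (antitone_sortedEigs X') hl
    ((charpoly_transpose_mul_self X').symm.trans h)

theorem sortedEigs_congr {n n' m : ℕ} {Y : Matrix (Fin n) (Fin m) ℝ}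
    {Z : Matrix (Fin n') (Fin m) ℝ} (h : (Yᵀ * Y).charpoly = (Zᵀ * Z).charpoly) :
    sortedEigs Y = sortedEigs Z :=
  sortedEigs_eq_of_charpoly (antitone_sortedEigs Z) (h.trans (charpoly_transpose_mul_self Z))

instance matBorelSpace (n m : ℕ) : BorelSpace (Matrix (Fin n) (Fin m) ℝ) :=
  (inferInstance : BorelSpace (Fin n → Fin m → ℝ))

theorem measurable_sortedEigs {n m : ℕ} :
    Measurable (sortedEigs : Matrix (Fin n) (Fin m) ℝ → Fin m → ℝ) := by
  set S : Set (Fin m → ℝ) := {l | Antitone l} with hS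
  have hSm : MeasurableSet S := by
    have : S = ⋂ i, ⋂ j, {l | i ≤ j → l j ≤ l i} := by
      ext l; simp [hS, Antitone]
    rw [this]
    refine MeasurableSet.iInter fun i => MeasurableSet.iInter fun j => ?_
    by_cases h : i ≤ j
    · simpa [h] using measurableSet_le (measurable_pi_apply j) (measurable_pi_apply i)
    · simp [h]
  set g : (Fin m → ℝ) → ℕ → ℝ := fun l k => ∏ i, ((k : ℝ) - l i) with hg
  have hgc : Continuous g := by
    refine continuous_pi fun k => ?_
    simp only [hg]
    fun_prop
  have hgi : Set.InjOn g S := by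
    intro l hl l' hl' h
    refine eq_of_antitone_of_prod_X_sub_C_eq hl hl' (Polynomial.eq_of_infinite_eval_eq _ _ ?_)
    refine (Set.infinite_range_of_injective (Nat.cast_injective (R := ℝ))).mono ?_
    rintro _ ⟨k, rfl⟩
    have := congrFun h k
    simpa [hg, Polynomial.eval_prod] using this
  have hemb := hgc.continuousOn.measurableEmbedding hSm hgi
  set s : Matrix (Fin n) (Fin m) ℝ → S := fun X => ⟨sortedEigs X, antitone_sortedEigs X⟩ with hs
  have hsm : Measurable s := by
    rw [← hemb.measurable_comp_iff, measurable_pi_iff]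
    intro k
    have : (fun X : Matrix (Fin n) (Fin m) ℝ => (S.domRestrict g ∘ s) X k) =
        fun X => (scalar (Fin m) (k : ℝ) - Xᵀ * X).det := by
      funext X
      rw [← eval_charpoly, charpoly_transpose_mul_self]
      simp [hs, hg, Polynomial.eval_prod]
    rw [this]
    refine Continuous.measurable ?_
    fun_prop
  exact measurable_subtype_coe.comp hsm

theorem exists_orthogonal_diagonalization {n : ℕ} {A : Matrix (Fin n) (Fin n) ℝ}
    (hA : A.IsHermitian) : ∃ U : Matrix (Fin n) (Fin n) ℝ, U * Uᵀ = 1 ∧ Uᵀ * U = 1 ∧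
      A = U * diagonal hA.eigenvalues * Uᵀ := by
  refine ⟨hA.eigenvectorUnitary, ?_, ?_, ?_⟩
  · rw [← conjTranspose_eq_transpose_of_trivial]
    exact Unitary.mul_star_self_of_mem hA.eigenvectorUnitary.2
  · rw [← conjTranspose_eq_transpose_of_trivial]
    exact Unitary.star_mul_self_of_mem hA.eigenvectorUnitary.2
  · conv_lhs => rw [hA.spectral_theorem]
    rw [Unitary.conjStarAlgAut_apply]
    rfl

theorem det_scalar_sub_diagonal_sub_vecMulVec {ι : Type*} [Fintype ι] [DecidableEq ι]
    (e y : ι → ℝ) {t : ℝ} (ht : ∀ i, t ≠ e i) :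
    (scalar ι t - (diagonal e + vecMulVec y y)).det =
      (∏ i, (t - e i)) * (1 - ∑ i, y i ^ 2 / (t - e i)) := by
  have h0 : ∀ i, t - e i ≠ 0 := fun i => sub_ne_zero.2 (ht i)
  have hD : scalar ι t - (diagonal e + vecMulVec y y) =
      diagonal (fun i => t - e i) + replicateCol Unit (-y) * replicateRow Unit y := by
    rw [← sub_sub, ← vecMulVec_eq, neg_vecMulVec, ← sub_eq_add_neg, scalar_apply,
      diagonal_sub]
  have hu : IsUnit (diagonal fun i => t - e i).det := by
    rw [det_diagonal]
    exact (Finset.prod_ne_zero_iff.2 fun i _ => h0 i).isUnit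
  rw [hD, det_add_replicateCol_mul_replicateRow hu, det_diagonal, det_unique,
    Matrix.inv_eq_right_inv (B := diagonal fun i => (t - e i)⁻¹)
      (by rw [diagonal_mul_diagonal]; simp [h0])]
  congr 1
  simp only [Matrix.add_apply, Matrix.one_apply_eq, Matrix.mul_apply, replicateRow_apply,
    replicateCol_apply, Pi.neg_apply, diagonal_apply, mul_ite, mul_zero, Finset.sum_ite_eq',
    Finset.mem_univ, if_true, mul_neg, Finset.sum_neg_distrib, ← sub_eq_add_neg]
  congr 1
  refine Finset.sum_congr rfl fun i _ => ?_
  ring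

/-- The vector `b` with `x` appended. -/
def appendLast {m : ℕ} (b : Fin m → ℝ) (x : ℝ) : Fin (m + 1) → ℝ := Fin.snoc (α := fun _ => ℝ) b x

@[simp] theorem appendLast_castSucc {m : ℕ} (b : Fin m → ℝ) (x : ℝ) (i : Fin m) :
    appendLast b x i.castSucc = b i := Fin.snoc_castSucc ..

@[simp] theorem appendLast_last {m : ℕ} (b : Fin m → ℝ) (x : ℝ) :
    appendLast b x (Fin.last m) = x := Fin.snoc_last ..

theorem measurable_appendLast {m : ℕ} {α : Type*} [MeasurableSpace α] {f : α → Fin m → ℝ}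
    {g : α → ℝ} (hf : Measurable f) (hg : Measurable g) :
    Measurable fun a => appendLast (f a) (g a) := by
  refine measurable_pi_iff.2 fun i => ?_
  refine Fin.lastCases ?_ (fun i => ?_) i
  · simpa using hg
  · simp only [appendLast_castSucc]
    exact (measurable_pi_apply i).comp hf

/-- The matrix `X` with the column `x` appended on the right. -/
def addCol {n m : ℕ} (X : Matrix (Fin n) (Fin m) ℝ) (x : Fin n → ℝ) :
    Matrix (Fin n) (Fin (m + 1)) ℝ := Matrix.of fun i => appendLast (X i) (x i)

theorem addCol_mul_transpose {n m : ℕ} (X : Matrix (Fin n) (Fin m) ℝ) (x : Fin n → ℝ) :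
    addCol X x * (addCol X x)ᵀ = X * Xᵀ + vecMulVec x x := by
  ext i j
  simp [addCol, Matrix.mul_apply, Fin.sum_univ_castSucc, vecMulVec_apply]

/-- A matrix `N` with `Nᵀ N = diag c + √q √qᵀ`. -/
noncomputable def secularMatrix {k : ℕ} (c q : Fin k → ℝ) : Matrix (Fin (k + 1)) (Fin k) ℝ :=
  Matrix.of fun i j => appendLast (fun i => diagonal (fun i => √(c i)) i j) (√(q j)) i

theorem measurable_secularMatrix {k : ℕ} (c : Fin k → ℝ) : Measurable (secularMatrix c) := by
  refine measurable_pi_iff.2 fun i => measurable_pi_iff.2 fun j => ?_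
  refine Fin.lastCases ?_ (fun i => ?_) i
  · simp only [secularMatrix, Matrix.of_apply, appendLast_last]
    fun_prop
  · simp only [secularMatrix, Matrix.of_apply, appendLast_castSucc]
    fun_prop

theorem secularMatrix_transpose_mul {k : ℕ} {c : Fin k → ℝ} (hc : ∀ i, 0 ≤ c i) (q : Fin k → ℝ) :
    (secularMatrix c q)ᵀ * secularMatrix c q =
      diagonal c + vecMulVec (fun i => √(q i)) (fun i => √(q i)) := by
  ext i j
  simp only [secularMatrix, Matrix.mul_apply, transpose_apply, Matrix.of_apply,
    Fin.sum_univ_castSucc, appendLast_castSucc, appendLast_last, Matrix.add_apply,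
    vecMulVec_apply]
  congr 1
  rcases eq_or_ne i j with rfl | h
  · rw [Finset.sum_eq_single i]
    · simp [Real.mul_self_sqrt (hc i)]
    · intro k _ hk
      simp [diagonal_apply_ne _ hk]
    · simp
  · rw [diagonal_apply_ne _ h]
    refine Finset.sum_eq_zero fun k _ => ?_
    rcases eq_or_ne k i with rfl | hk
    · simp [diagonal_apply_ne _ h]
    · simp [diagonal_apply_ne _ hk]

theorem eval_charpoly_secularMatrix {k : ℕ} {c q : Fin k → ℝ} (hc : ∀ i, 0 ≤ c i)
    (hq : ∀ i, 0 ≤ q i) {t : ℝ} (ht : ∀ i, t ≠ c i) :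
    ((secularMatrix c q)ᵀ * secularMatrix c q).charpoly.eval t =
      (∏ i, (t - c i)) * (1 - ∑ i, q i / (t - c i)) := by
  rw [eval_charpoly, secularMatrix_transpose_mul hc,
    det_scalar_sub_diagonal_sub_vecMulVec _ _ ht]
  simp only [Real.sq_sqrt (hq _)]

theorem polynomial_eq_of_eval_eq_of_ne {k : ℕ} {P Q : Polynomial ℝ} (c : Fin k → ℝ)
    (h : ∀ t, (∀ i, t ≠ c i) → P.eval t = Q.eval t) : P = Q := by
  refine Polynomial.eq_of_infinite_eval_eq _ _ ((Set.finite_range c).infinite_compl.mono ?_)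
  exact fun t ht => h t fun i hi => ht ⟨i, hi.symm⟩

theorem sortedEigs_secularMatrix {k : ℕ} {c l : Fin k → ℝ} (hc : StrictAnti c)
    (hc0 : ∀ i, 0 ≤ c i) (hl : l ∈ interlacing c) :
    sortedEigs (secularMatrix c (residues c l)) = l := by
  refine sortedEigs_eq_of_charpoly (strictAnti_of_interlacing hl).antitone
    (polynomial_eq_of_eval_eq_of_ne c fun t ht => ?_)
  rw [eval_charpoly_secularMatrix hc0 (fun i => (residues_pos hc hl i).le) ht,
    ← prod_sub_eq_secular hc.injective l ht]
  simp [Polynomial.eval_prod]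

open Polynomial in
theorem exists_diagonalization_mul_transpose {n m d : ℕ} (hn : n = m + d)
    (Y : Matrix (Fin n) (Fin m) ℝ) : ∃ (U : Matrix (Fin n) (Fin n) ℝ) (e : Fin n → ℝ)
      (σ : Fin m ⊕ Fin d ≃ Fin n), U * Uᵀ = 1 ∧ Uᵀ * U = 1 ∧ Y * Yᵀ = U * diagonal e * Uᵀ ∧
        ∀ a, e (σ a) = Sum.elim (sortedEigs Y) 0 a := by
  have hA : (Y * Yᵀ).IsHermitian := by
    simpa using isHermitian_mul_conjTranspose_self Y
  obtain ⟨U, h1, h2, h3⟩ := exists_orthogonal_diagonalization hA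
  have hp : ∏ a, (X - C ((Sum.elim (sortedEigs Y) 0 : Fin m ⊕ Fin d → ℝ) a)) =
      ∏ i, (X - C (hA.eigenvalues i)) := by
    have hpow : (X : ℝ[X]) ^ n = X ^ m * X ^ d := by rw [hn, pow_add]
    have h4 := charpoly_mul_comm' Y Yᵀ
    rw [charpoly_transpose_mul_self, hA.charpoly_eq, Fintype.card_fin, Fintype.card_fin, hpow,
      mul_assoc] at h4
    have h5 := mul_left_cancel₀ (pow_ne_zero m X_ne_zero) h4
    rw [Fintype.prod_sum_type]
    simp only [Sum.elim_inl, Sum.elim_inr, Pi.zero_apply, C_0, sub_zero, Finset.prod_const,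
      Finset.card_univ, Fintype.card_fin]
    rw [mul_comm, ← h5]
    rfl
  obtain ⟨σ, hσ⟩ := exists_equiv_of_prod_X_sub_C_eq hp
  exact ⟨U, hA.eigenvalues, σ, h1, h2, h3, hσ⟩

theorem eval_charpoly_transpose_mul_self {n p : ℕ} (M : Matrix (Fin n) (Fin p) ℝ) (t : ℝ) :
    t ^ n * (Mᵀ * M).charpoly.eval t = t ^ p * (scalar (Fin n) t - M * Mᵀ).det := by
  have h := congrArg (Polynomial.eval t) (charpoly_mul_comm' Mᵀ M)
  rw [← eval_charpoly]
  simpa using h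

theorem det_scalar_sub_conj {n : ℕ} {U : Matrix (Fin n) (Fin n) ℝ} (h : U * Uᵀ = 1) (t : ℝ)
    (B : Matrix (Fin n) (Fin n) ℝ) :
    (scalar (Fin n) t - U * B * Uᵀ).det = (scalar (Fin n) t - B).det := by
  have h1 : scalar (Fin n) t - U * B * Uᵀ = U * (scalar (Fin n) t - B) * Uᵀ := by
    rw [mul_sub, sub_mul, ← scalar_comm t (fun r => mul_comm t r) U, mul_assoc _ U, h, mul_one]
  have h2 : U.det * Uᵀ.det = 1 := by rw [← det_mul, h, det_one]
  rw [h1, det_mul, det_mul, mul_right_comm, h2, one_mul]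

theorem eval_charpoly_addCol {n m d : ℕ} (hn : n = m + d)
    {Y : Matrix (Fin n) (Fin m) ℝ} {U : Matrix (Fin n) (Fin n) ℝ} {e : Fin n → ℝ}
    {σ : Fin m ⊕ Fin d ≃ Fin n} {b : Fin m → ℝ} (h1 : U * Uᵀ = 1)
    (h3 : Y * Yᵀ = U * diagonal e * Uᵀ) (hσ : ∀ a, e (σ a) = Sum.elim b 0 a)
    (x : Fin n → ℝ) {t : ℝ} (ht : ∀ i, t ≠ appendLast b 0 i) :
    ((addCol Y x)ᵀ * addCol Y x).charpoly.eval t =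
      (∏ i, (t - appendLast b 0 i)) *
        (1 - ∑ i, appendLast (fun j => (Uᵀ *ᵥ x) (σ (Sum.inl j)) ^ 2)
          (∑ k, (Uᵀ *ᵥ x) (σ (Sum.inr k)) ^ 2) i / (t - appendLast b 0 i)) := by
  have ht0 : t ≠ 0 := by simpa using ht (Fin.last m)
  have htb : ∀ j, t ≠ b j := fun j => by simpa using ht j.castSucc
  have h := eval_charpoly_transpose_mul_self (addCol Y x) t
  set y := Uᵀ *ᵥ x with hy
  have hx : x = U *ᵥ y := by rw [hy, mulVec_mulVec, h1, one_mulVec]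
  have hv : vecMulVec x x = U * vecMulVec y y * Uᵀ := by
    rw [mul_vecMulVec, vecMulVec_mul, vecMul_transpose, ← hx]
  have hte : ∀ i, t ≠ e i := by
    intro i
    rw [← σ.apply_symm_apply i, hσ]
    rcases σ.symm i with j | k
    · exact htb j
    · exact ht0
  rw [addCol_mul_transpose, h3, hv, ← add_mul, ← mul_add, det_scalar_sub_conj h1,
    det_scalar_sub_diagonal_sub_vecMulVec _ _ hte, ← Equiv.prod_comp σ, ← Equiv.sum_comp σ] at h
  simp only [hσ, Fintype.prod_sum_type, Fintype.sum_sum_type, Sum.elim_inl, Sum.elim_inr,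
    Pi.zero_apply, sub_zero, Finset.prod_const, Finset.card_univ, Fintype.card_fin] at h
  simp only [Fin.prod_univ_castSucc, Fin.sum_univ_castSucc, appendLast_castSucc, appendLast_last,
    sub_zero, Finset.sum_div]
  have hpow : t ^ n = t ^ m * t ^ d := by rw [hn, pow_add]
  refine mul_left_cancel₀ (pow_ne_zero n ht0) (h.trans ?_)
  rw [hpow]
  ring

theorem sortedEigs_addCol {n m d : ℕ} (hn : n = m + d)
    {Y : Matrix (Fin n) (Fin m) ℝ} {U : Matrix (Fin n) (Fin n) ℝ} {e : Fin n → ℝ}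
    {σ : Fin m ⊕ Fin d ≃ Fin n} {b : Fin m → ℝ} (h1 : U * Uᵀ = 1)
    (h3 : Y * Yᵀ = U * diagonal e * Uᵀ) (hσ : ∀ a, e (σ a) = Sum.elim b 0 a)
    (hb : ∀ i, 0 ≤ b i) (x : Fin n → ℝ) :
    sortedEigs (addCol Y x) = sortedEigs (secularMatrix (appendLast b 0)
      (appendLast (fun j => (Uᵀ *ᵥ x) (σ (Sum.inl j)) ^ 2)
        (∑ k, (Uᵀ *ᵥ x) (σ (Sum.inr k)) ^ 2))) := by
  refine sortedEigs_congr (polynomial_eq_of_eval_eq_of_ne (appendLast b 0) fun t ht => ?_)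
  rw [eval_charpoly_addCol hn h1 h3 hσ x ht, eval_charpoly_secularMatrix _ _ ht]
  · refine fun i => Fin.lastCases ?_ (fun i => ?_) i
    · simp
    · simpa using hb i
  · refine fun i => Fin.lastCases ?_ (fun i => ?_) i
    · simpa using Finset.sum_nonneg fun i _ => sq_nonneg _
    · simpa using sq_nonneg _

theorem lintegral_mulVec_orthogonal {n : ℕ} {U : Matrix (Fin n) (Fin n) ℝ} (h : U * Uᵀ = 1)
    {f : (Fin n → ℝ) → ENNReal} (hf : Measurable f) : ∫⁻ x, f (U *ᵥ x) = ∫⁻ x, f x := by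
  have hd : |U.det| = 1 := by
    have h2 : U.det * U.det = 1 := by
      have := congrArg det h
      rwa [det_mul, det_transpose, det_one] at this
    rcases mul_self_eq_one_iff.1 h2 with h | h <;> simp [h]
  have h0 : U.det ≠ 0 := by
    intro h0; rw [h0] at hd; simp at hd
  have h2 := Real.map_matrix_volume_pi_eq_smul_volume_pi h0
  rw [abs_inv, hd, inv_one, ENNReal.ofReal_one, one_smul] at h2
  conv_rhs => rw [← h2]
  rw [lintegral_map hf (LinearMap.continuous_of_finiteDimensional _).measurable]
  rfl

theorem residues_appendLast_last {m : ℕ} {b : Fin m → ℝ} {l : Fin (m + 1) → ℝ}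
    (hb : StrictAnti (appendLast b 0)) (hb0 : ∀ i, 0 < b i)
    (hl : l ∈ interlacing (appendLast b 0)) :
    residues (appendLast b 0) l (Fin.last m) = (∏ j, l j) / ∏ j, b j := by
  have hl0 : ∀ j, 0 < l j := fun j => by
    simpa using (hl (Fin.last m) j).1 (Fin.le_last j)
  rw [residues_eq_abs hb hl]
  congr 1
  · simp [abs_of_pos (hl0 _)]
  · have : Finset.univ.erase (Fin.last m) = Finset.univ.map Fin.castSuccEmb := by
      ext j
      refine Fin.lastCases ?_ (fun j => ?_) j
      · simp
      · simp
    rw [this, Finset.prod_map]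
    simp [abs_of_pos (hb0 _)]

theorem lintegral_sortedEigs_addCol {n m d : ℕ} (hn : n = m + d) (hd : 1 ≤ d)
    {Y : Matrix (Fin n) (Fin m) ℝ} {b : Fin m → ℝ} (hY : sortedEigs Y = b)
    (hb : StrictAnti b) (hb0 : ∀ i, 0 < b i) {F : (Fin (m + 1) → ℝ) → ENNReal}
    (hF : Measurable F) :
    ∫⁻ x : Fin n → ℝ, F (sortedEigs (addCol Y x)) =
      ENNReal.ofReal (π ^ ((d : ℝ) / 2) / Real.Gamma (d / 2)) *
        ∫⁻ l in interlacing (appendLast b 0),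
          ENNReal.ofReal (absVandermonde l *
            ∏ i, ∏ j, |appendLast b 0 i - l j| ^ (-(1 / 2) : ℝ)) *
          (ENNReal.ofReal (((∏ j, l j) / ∏ j, b j) ^ (((d : ℝ) - 1) / 2)) * F l) := by
  set c := appendLast b 0 with hc
  have hcn : ∀ i, 0 ≤ c i := by
    refine fun i => Fin.lastCases ?_ (fun i => ?_) i
    · simp [hc]
    · simpa [hc] using (hb0 i).le
  have hca : StrictAnti c := by
    intro i j
    refine Fin.lastCases ?_ (fun i => ?_) i
    · intro h; exact absurd h (Fin.le_last j).not_gt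
    · refine Fin.lastCases ?_ (fun j => ?_) j
      · intro _; simpa [hc] using hb0 i
      · intro h; simpa [hc] using hb (Fin.castSucc_lt_castSucc_iff.1 h)
  obtain ⟨U, e, σ, h1, h2, h3, hσ⟩ := exists_diagonalization_mul_transpose hn Y
  rw [hY] at hσ
  set G : (Fin (m + 1) → ℝ) → ENNReal := fun q => F (sortedEigs (secularMatrix c q)) with hG
  have hGm : Measurable G :=
    hF.comp (measurable_sortedEigs.comp (measurable_secularMatrix c))
  set f : (Fin (m + 1) → ℝ) → ENNReal := fun p =>
    ENNReal.ofReal ((p (Fin.last m)) ^ (((d : ℝ) - 1) / 2)) * G p with hf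
  have hfm : Measurable f := by
    refine Measurable.mul ?_ hGm
    fun_prop
  have hΦ : Measurable fun y : Fin n → ℝ => G (appendLast (fun j => y (σ (Sum.inl j)) ^ 2)
      (∑ k, y (σ (Sum.inr k)) ^ 2)) :=
    hGm.comp (measurable_appendLast (by fun_prop) (by fun_prop))
  calc ∫⁻ x : Fin n → ℝ, F (sortedEigs (addCol Y x))
      = ∫⁻ x : Fin n → ℝ, G (appendLast (fun j => (Uᵀ *ᵥ x) (σ (Sum.inl j)) ^ 2)
        (∑ k, (Uᵀ *ᵥ x) (σ (Sum.inr k)) ^ 2)) := by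
        refine lintegral_congr fun x => ?_
        rw [sortedEigs_addCol hn h1 h3 hσ fun i => (hb0 i).le]
    _ = ∫⁻ y : Fin n → ℝ, G (appendLast (fun j => y (σ (Sum.inl j)) ^ 2)
        (∑ k, y (σ (Sum.inr k)) ^ 2)) :=
        lintegral_mulVec_orthogonal (U := Uᵀ) (by rwa [transpose_transpose]) hΦ
    _ = ∫⁻ z : Fin m ⊕ Fin d → ℝ, G (appendLast (fun j => z (Sum.inl j) ^ 2)
        (∑ k, z (Sum.inr k) ^ 2)) := by
        rw [← (volume_measurePreserving_piCongrLeft (fun _ : Fin n => ℝ) σ).lintegral_comp hΦ]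
        refine lintegral_congr fun z => ?_
        have : ∀ a, MeasurableEquiv.piCongrLeft (fun _ : Fin n => ℝ) σ z (σ a) = z a := fun a =>
          Equiv.piCongrLeft_apply_apply (fun _ : Fin n => ℝ) σ z a
        simp only [this]
    _ = ∫⁻ p : (Fin m → ℝ) × (Fin d → ℝ), G (appendLast (fun j => p.1 j ^ 2)
        (∑ k, p.2 k ^ 2)) := by
        rw [← (volume_measurePreserving_sumPiEquivProdPi
          (fun _ : Fin m ⊕ Fin d => ℝ)).lintegral_comp]
        · rfl
        · exact hGm.comp (measurable_appendLast (by fun_prop) (by fun_prop))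
    _ = ∫⁻ u : Fin m → ℝ, ∫⁻ w : Fin d → ℝ, G (appendLast (fun j => u j ^ 2)
        (∑ k, w k ^ 2)) := by
        rw [Measure.volume_eq_prod, lintegral_prod]
        exact (hGm.comp (measurable_appendLast (by fun_prop) (by fun_prop))).aemeasurable
    _ = ∫⁻ u : Fin m → ℝ, ENNReal.ofReal (π ^ ((d : ℝ) / 2) / Real.Gamma (d / 2)) *
        ∫⁻ s : ℝ, ENNReal.ofReal ((s ^ 2) ^ (((d : ℝ) - 1) / 2)) *
          G (appendLast (fun j => u j ^ 2) (s ^ 2)) := by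
        refine lintegral_congr fun u => ?_
        exact lintegral_comp_sum_sq hd (g := fun s => G (appendLast (fun j => u j ^ 2) s))
          (hGm.comp (measurable_appendLast measurable_const measurable_id))
    _ = ENNReal.ofReal (π ^ ((d : ℝ) / 2) / Real.Gamma (d / 2)) *
        ∫⁻ v : Fin (m + 1) → ℝ, f (fun i => v i ^ 2) := by
        have hm2 : Measurable fun p : ℝ × (Fin m → ℝ) =>
            ENNReal.ofReal ((p.1 ^ 2) ^ (((d : ℝ) - 1) / 2)) *
              G (appendLast (fun j => p.2 j ^ 2) (p.1 ^ 2)) :=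
          Measurable.mul (by fun_prop)
            (hGm.comp (measurable_appendLast (by fun_prop) (by fun_prop)))
        rw [lintegral_const_mul _ hm2.lintegral_prod_left']
        congr 1
        rw [← lintegral_prod_symm' _ hm2, ← Measure.volume_eq_prod,
          ← (volume_preserving_piFinSuccAbove (fun _ => ℝ) (Fin.last m)).lintegral_comp hm2]
        refine lintegral_congr fun v => ?_
        simp only [hf, MeasurableEquiv.piFinSuccAbove_apply]
        congr 2
        funext i
        refine Fin.lastCases ?_ (fun i => ?_) i
        · simp [Fin.insertNthEquiv]
        · simp [Fin.insertNthEquiv, Fin.init]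
    _ = _ := by
        rw [lintegral_comp_sq_interlacing hca hfm]
        congr 1
        refine setLIntegral_congr_fun (measurableSet_interlacing c) fun l hl => ?_
        simp only [hf, hG]
        rw [sortedEigs_secularMatrix hca hcn hl, residues_appendLast_last hca hb0 hl]

/-- The strictly decreasing positive vectors. -/
def posChamber (m : ℕ) : Set (Fin m → ℝ) := {l | StrictAnti l ∧ ∀ i, 0 < l i}

theorem measurableSet_posChamber (m : ℕ) : MeasurableSet (posChamber m) := by
  have : posChamber m = (⋂ i, ⋂ j, {l | i < j → l j < l i}) ∩ ⋂ i, {l | 0 < l i} := by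
    ext l; simp [posChamber, StrictAnti]
  rw [this]
  refine MeasurableSet.inter (MeasurableSet.iInter fun i => MeasurableSet.iInter fun j => ?_)
    (MeasurableSet.iInter fun i => measurableSet_lt measurable_const (measurable_pi_apply i))
  by_cases h : i < j
  · simpa [h] using measurableSet_lt (measurable_pi_apply j) (measurable_pi_apply i)
  · simp [h]

theorem mem_interlacing_appendLast_iff {m : ℕ} {b : Fin m → ℝ} {l : Fin (m + 1) → ℝ} :
    l ∈ interlacing (appendLast b 0) ↔ b ∈ interlacingBelow l ∧ ∀ j, 0 < l j := by
  constructor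
  · intro h
    refine ⟨fun i j => ⟨fun hij => ?_, fun hij => ?_⟩, fun j => ?_⟩
    · simpa using (h i.castSucc j).1 hij
    · simpa using (h i.castSucc j).2 hij
    · simpa using (h (Fin.last m) j).1 (Fin.le_last j)
  · rintro ⟨h1, h2⟩ i j
    refine Fin.lastCases ?_ (fun i => ?_) i
    · simpa using ⟨fun _ => h2 j, fun h => absurd h (Fin.le_last j).not_gt⟩
    · simpa using h1 i j

theorem posChamber_interlacing_iff {m : ℕ} {b : Fin m → ℝ} {l : Fin (m + 1) → ℝ} :
    b ∈ posChamber m ∧ l ∈ interlacing (appendLast b 0) ↔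
      l ∈ posChamber (m + 1) ∧ b ∈ interlacingBelow l := by
  rw [mem_interlacing_appendLast_iff]
  constructor
  · rintro ⟨h1, h2, h3⟩
    exact ⟨⟨strictAnti_of_interlacing (mem_interlacing_appendLast_iff.2 ⟨h2, h3⟩), h3⟩, h2⟩
  · rintro ⟨h1, h2⟩
    refine ⟨⟨fun i j hij => ?_, fun i => ?_⟩, h2, h1.2⟩
    · exact ((h2 j j.castSucc).1 le_rfl).trans ((h2 i j.castSucc).2 hij)
    · exact (h1.2 _).trans ((h2 i i.succ).2 (Fin.castSucc_lt_succ (i := i)))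

theorem measurableSet_posChamber_interlacingBelow (m : ℕ) :
    MeasurableSet {p : (Fin m → ℝ) × (Fin (m + 1) → ℝ) |
      p.2 ∈ posChamber (m + 1) ∧ p.1 ∈ interlacingBelow p.2} := by
  have : {p : (Fin m → ℝ) × (Fin (m + 1) → ℝ) | p.1 ∈ interlacingBelow p.2} =
      ⋂ i, ⋂ j, {p | (j ≤ Fin.castSucc i → p.1 i < p.2 j) ∧
        (Fin.castSucc i < j → p.2 j < p.1 i)} := by
    ext; simp [interlacingBelow]
  refine MeasurableSet.inter (measurable_snd (measurableSet_posChamber _))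
    (s₂ := {p | p.1 ∈ interlacingBelow p.2}) ?_
  rw [this]
  refine MeasurableSet.iInter fun i => MeasurableSet.iInter fun j => ?_
  rcases le_or_gt j i.castSucc with h | h
  · simp only [h, h.not_gt, true_imp_iff, false_imp_iff, and_true]
    exact measurableSet_lt (by fun_prop) (by fun_prop)
  · simp only [h, h.not_ge, true_imp_iff, false_imp_iff, true_and]
    exact measurableSet_lt (by fun_prop) (by fun_prop)

theorem measurable_addCol {n m : ℕ} :
    Measurable fun p : (Fin n → ℝ) × Matrix (Fin n) (Fin m) ℝ => addCol p.2 p.1 := by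
  refine measurable_pi_iff.2 fun i => ?_
  exact measurable_appendLast ((measurable_pi_apply i).comp measurable_snd)
    ((measurable_pi_apply i).comp measurable_fst)

theorem lintegral_matrix_addCol {n m : ℕ} {f : Matrix (Fin n) (Fin (m + 1)) ℝ → ENNReal}
    (hf : Measurable f) :
    ∫⁻ X, f X = ∫⁻ Y : Matrix (Fin n) (Fin m) ℝ, ∫⁻ x : Fin n → ℝ, f (addCol Y x) := by
  have h1 : MeasurePreserving (fun (X : Fin n → Fin (m + 1) → ℝ) i =>
      MeasurableEquiv.piFinSuccAbove (fun _ => ℝ) (Fin.last m) (X i)) volume volume :=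
    volume_preserving_pi fun i => volume_preserving_piFinSuccAbove (fun _ => ℝ) (Fin.last m)
  have h2 := (volume_measurePreserving_arrowProdEquivProdArrow ℝ (Fin m → ℝ) (Fin n)).comp h1
  have hm : Measurable fun p : (Fin n → ℝ) × Matrix (Fin n) (Fin m) ℝ => f (addCol p.2 p.1) :=
    hf.comp measurable_addCol
  have h3 := h2.lintegral_comp hm
  rw [Measure.volume_eq_prod] at h3
  refine Eq.trans ?_ (h3.trans (lintegral_prod_symm _ hm.aemeasurable))
  refine lintegral_congr fun X => congrArg f ?_
  ext i j
  refine Fin.lastCases ?_ (fun j => ?_) j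
  · simp [addCol, MeasurableEquiv.arrowProdEquivProdArrow, Equiv.arrowProdEquivProdArrow,
      MeasurableEquiv.piFinSuccAbove, Fin.insertNthEquiv]
    rfl
  · simp [addCol, MeasurableEquiv.arrowProdEquivProdArrow, Equiv.arrowProdEquivProdArrow,
      MeasurableEquiv.piFinSuccAbove, Fin.insertNthEquiv]
    rfl

/-- The constant in the joint distribution of the eigenvalues of `XᵀX`. -/
noncomputable def specConst (n : ℕ) : ℕ → ℝ
  | 0 => 1
  | m + 1 => specConst n m *
      ((π ^ ((n - m : ℝ) / 2) / Real.Gamma ((n - m : ℝ) / 2)) *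
        (π ^ (((m : ℝ) + 1) / 2) / Real.Gamma (((m : ℝ) + 1) / 2)))

theorem specConst_pos {n : ℕ} : ∀ {m : ℕ}, m ≤ n → 0 < specConst n m
  | 0, _ => one_pos
  | m + 1, h => by
    have h1 : (0 : ℝ) < (n - m : ℝ) / 2 := by
      have : (m : ℝ) + 1 ≤ n := by exact_mod_cast h
      linarith
    have h2 : (0 : ℝ) < ((m : ℝ) + 1) / 2 := by positivity
    have := specConst_pos (m := m) (Nat.le_of_succ_le h)
    have := Real.Gamma_pos_of_pos h1
    have := Real.Gamma_pos_of_pos h2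
    rw [specConst]
    positivity

/-- The unnormalized joint density of the ordered eigenvalues of `XᵀX`. -/
noncomputable def eigDensity (n : ℕ) {m : ℕ} (l : Fin m → ℝ) : ℝ :=
  (∏ i, l i) ^ (((n : ℝ) - m - 1) / 2) * absVandermonde l

theorem measurable_eigDensity {n m : ℕ} : Measurable (eigDensity n : (Fin m → ℝ) → ℝ) := by
  unfold eigDensity
  exact Measurable.mul (by fun_prop) measurable_absVandermonde

theorem eigDensity_mul_kernel {n m d : ℕ} (hn : n = m + d) {b : Fin m → ℝ}
    {l : Fin (m + 1) → ℝ} (hb : ∀ i, 0 < b i) (hl : ∀ i, 0 < l i) :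
    eigDensity n b * ((absVandermonde l * ∏ i, ∏ j, |appendLast b 0 i - l j| ^ (-(1 / 2) : ℝ)) *
      ((∏ j, l j) / ∏ j, b j) ^ (((d : ℝ) - 1) / 2)) =
    eigDensity n l * (absVandermonde b * ∏ i, ∏ j, |b i - l j| ^ (-(1 / 2) : ℝ)) := by
  have hB : 0 < ∏ j, b j := Finset.prod_pos fun j _ => hb j
  have hL : 0 < ∏ j, l j := Finset.prod_pos fun j _ => hl j
  have h1 : ∏ j, |(0 : ℝ) - l j| ^ (-(1 / 2) : ℝ) = (∏ j, l j) ^ (-(1 / 2) : ℝ) := by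
    rw [← Real.finsetProd_rpow _ _ fun j _ => (hl j).le]
    exact Finset.prod_congr rfl fun j _ => by rw [zero_sub, abs_neg, abs_of_pos (hl j)]
  rw [Fin.prod_univ_castSucc]
  simp only [appendLast_castSucc, appendLast_last, h1, eigDensity]
  rw [Real.div_rpow hL.le hB.le]
  have h2 : ((n : ℝ) - m - 1) / 2 = ((d : ℝ) - 1) / 2 := by rw [hn]; push_cast; ring
  have h3 : ((n : ℝ) - (m + 1 : ℕ) - 1) / 2 = -(1 / 2) + ((d : ℝ) - 1) / 2 := by
    rw [hn]; push_cast; ring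
  rw [h2, h3, Real.rpow_add hL]
  have : (∏ j, b j) ^ (((d : ℝ) - 1) / 2) ≠ 0 := (Real.rpow_pos_of_pos hB _).ne'
  field_simp

/-- The joint distribution of the ordered eigenvalues of `XᵀX` under Lebesgue measure. -/
theorem lintegral_sortedEigs {n : ℕ} : ∀ {m : ℕ}, m ≤ n → ∀ {F : (Fin m → ℝ) → ENNReal},
    Measurable F → ∫⁻ X : Matrix (Fin n) (Fin m) ℝ, F (sortedEigs X) =
      ENNReal.ofReal (specConst n m) *
        ∫⁻ l in posChamber m, ENNReal.ofReal (eigDensity n l) * F l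
  | 0, _, F, hF => by
    have h0 : ∀ l : Fin 0 → ℝ, l = default := fun l => Subsingleton.elim _ _
    have hp : posChamber 0 = Set.univ := by
      ext l; simp [posChamber, StrictAnti]
    have hv : (volume : Measure (Matrix (Fin n) (Fin 0) ℝ)) Set.univ = 1 := by
      change (volume : Measure (Fin n → Fin 0 → ℝ)) Set.univ = 1
      rw [volume_pi, Measure.pi_univ]
      simp [volume_pi]
    have hw : (volume : Measure (Fin 0 → ℝ)) Set.univ = 1 := by
      simp [volume_pi]
    rw [hp, Measure.restrict_univ, lintegral_congr (g := fun _ => F default)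
      (fun X => by rw [h0 (sortedEigs X)]), lintegral_congr (f := fun l =>
      ENNReal.ofReal (eigDensity n l) * F l) (g := fun _ => F default)
      (fun l => by rw [h0 l]; simp [eigDensity, absVandermonde]), lintegral_const,
      lintegral_const, hv, hw]
    simp [specConst]
  | m + 1, h, F, hF => by
    obtain ⟨d, hn⟩ : ∃ d, n = m + d := Nat.exists_eq_add_of_le (Nat.le_of_succ_le h)
    have hd : 1 ≤ d := by omega
    have IH := @lintegral_sortedEigs n m (Nat.le_of_succ_le h)
    have hae : ∀ᵐ Y : Matrix (Fin n) (Fin m) ℝ, sortedEigs Y ∈ posChamber m := by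
      have hmc := (measurableSet_posChamber m).compl
      have := IH (F := (posChamber m)ᶜ.indicator fun _ => 1) (measurable_const.indicator hmc)
      rw [setLIntegral_congr_fun (g := fun _ => 0) (measurableSet_posChamber m)
        (fun l hl => by simp [hl])] at this
      simp only [lintegral_zero, mul_zero] at this
      replace this := (lintegral_eq_zero_iff
        (f := fun X : Matrix (Fin n) (Fin m) ℝ =>
          (posChamber m)ᶜ.indicator (fun _ => (1 : ENNReal)) (sortedEigs X))
        ((measurable_const.indicator hmc).comp measurable_sortedEigs)).1 this
      filter_upwards [this] with Y hY
      by_contra hc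
      simp [hc] at hY
    set S : Set ((Fin m → ℝ) × (Fin (m + 1) → ℝ)) :=
      {p | p.2 ∈ posChamber (m + 1) ∧ p.1 ∈ interlacingBelow p.2} with hS
    have hSm : MeasurableSet S := measurableSet_posChamber_interlacingBelow m
    set J : (Fin m → ℝ) × (Fin (m + 1) → ℝ) → ENNReal := fun p =>
      ENNReal.ofReal (absVandermonde p.2 *
        ∏ i, ∏ j, |appendLast p.1 0 i - p.2 j| ^ (-(1 / 2) : ℝ)) *
        (ENNReal.ofReal (((∏ j, p.2 j) / ∏ j, p.1 j) ^ (((d : ℝ) - 1) / 2)) * F p.2) with hJ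
    have hJm : Measurable J := by
      have h1 : Measurable fun p : (Fin m → ℝ) × (Fin (m + 1) → ℝ) => appendLast p.1 0 :=
        measurable_appendLast measurable_fst measurable_const
      have h2 : ∀ i, Measurable fun p : (Fin m → ℝ) × (Fin (m + 1) → ℝ) => appendLast p.1 0 i :=
        fun i => (measurable_pi_apply i).comp h1
      have h3 : Measurable fun p : (Fin m → ℝ) × (Fin (m + 1) → ℝ) => absVandermonde p.2 :=
        measurable_absVandermonde.comp measurable_snd
      have h4 : Measurable fun p : (Fin m → ℝ) × (Fin (m + 1) → ℝ) => F p.2 :=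
        hF.comp measurable_snd
      refine Measurable.mul (Measurable.ennreal_ofReal (h3.mul ?_))
        (Measurable.mul (Measurable.ennreal_ofReal ?_) h4)
      · refine Finset.measurable_fun_prod _ fun i _ => Finset.measurable_fun_prod _ fun j _ => ?_
        have := h2 i
        fun_prop
      · fun_prop
    set G1 : ENNReal := ENNReal.ofReal (π ^ ((d : ℝ) / 2) / Real.Gamma (d / 2)) with hG1
    set G2 : ENNReal := ENNReal.ofReal
      (π ^ (((m : ℝ) + 1) / 2) / Real.Gamma (((m : ℝ) + 1) / 2)) with hG2
    have hSJ : Measurable (S.indicator J) := hJm.indicator hSm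
    have key : ∀ b l, (posChamber m).indicator (fun b => ENNReal.ofReal (eigDensity n b) *
          S.indicator J (b, l)) b =
        (posChamber (m + 1)).indicator (fun l => ENNReal.ofReal (eigDensity n l) * F l) l *
          (interlacingBelow l).indicator (fun b => ENNReal.ofReal (absVandermonde b *
            ∏ i, ∏ j, |b i - l j| ^ (-(1 / 2) : ℝ))) b := by
      intro b l
      by_cases hp : l ∈ posChamber (m + 1) ∧ b ∈ interlacingBelow l
      · have hb := (posChamber_interlacing_iff.2 hp).1
        rw [Set.indicator_of_mem hb, Set.indicator_of_mem (show (b, l) ∈ S from hp),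
          Set.indicator_of_mem hp.1, Set.indicator_of_mem hp.2, hJ]
        simp only
        have hV : 0 ≤ eigDensity n b := mul_nonneg (Real.rpow_nonneg
          (Finset.prod_nonneg fun i _ => (hb.2 i).le) _) (absVandermonde_nonneg _)
        have hV2 : 0 ≤ eigDensity n l := mul_nonneg (Real.rpow_nonneg
          (Finset.prod_nonneg fun i _ => (hp.1.2 i).le) _) (absVandermonde_nonneg _)
        have hK : 0 ≤ absVandermonde l *
            ∏ i, ∏ j, |appendLast b 0 i - l j| ^ (-(1 / 2) : ℝ) :=
          mul_nonneg (absVandermonde_nonneg _) (by positivity)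
        rw [← mul_assoc (ENNReal.ofReal _) (ENNReal.ofReal _) (F l), ← ENNReal.ofReal_mul hK,
          ← mul_assoc, ← ENNReal.ofReal_mul hV, eigDensity_mul_kernel hn hb.2 hp.1.2,
          ENNReal.ofReal_mul hV2]
        ring
      · have h1 : (b, l) ∉ S := hp
        have h2 : (posChamber m).indicator (fun b => ENNReal.ofReal (eigDensity n b) *
            S.indicator J (b, l)) b = 0 := Set.indicator_apply_eq_zero.2 fun _ => by simp [h1]
        rw [h2]
        rw [not_and_or] at hp
        rcases hp with hp | hp <;> simp [hp]
    calc ∫⁻ X : Matrix (Fin n) (Fin (m + 1)) ℝ, F (sortedEigs X)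
        = ∫⁻ Y : Matrix (Fin n) (Fin m) ℝ, ∫⁻ x : Fin n → ℝ, F (sortedEigs (addCol Y x)) :=
          lintegral_matrix_addCol (hF.comp measurable_sortedEigs)
      _ = ∫⁻ Y : Matrix (Fin n) (Fin m) ℝ,
            G1 * ∫⁻ l, S.indicator J (sortedEigs Y, l) := by
          refine lintegral_congr_ae ?_
          filter_upwards [hae] with Y hY
          rw [lintegral_sortedEigs_addCol hn hd rfl hY.1 hY.2 hF]
          have hms : MeasurableSet (interlacing (appendLast (sortedEigs Y) 0)) := by
            have : interlacing (appendLast (sortedEigs Y) 0) =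
                (fun l => (sortedEigs Y, l)) ⁻¹' S := by
              ext l
              change _ ↔ _ ∧ _
              rw [← posChamber_interlacing_iff]
              simp [hY]
            rw [this]
            exact measurable_prodMk_left hSm
          rw [← lintegral_indicator hms]
          congr 1
          refine lintegral_congr fun l => ?_
          have : l ∈ interlacing (appendLast (sortedEigs Y) 0) ↔ (sortedEigs Y, l) ∈ S := by
            change _ ↔ _ ∧ _
            rw [← posChamber_interlacing_iff]
            simp [hY]
          by_cases hl : (sortedEigs Y, l) ∈ S
          · rw [Set.indicator_of_mem hl, Set.indicator_of_mem (this.2 hl)]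
          · rw [Set.indicator_of_notMem hl, Set.indicator_of_notMem (fun h => hl (this.1 h))]
      _ = ENNReal.ofReal (specConst n m) * ∫⁻ b in posChamber m,
            ENNReal.ofReal (eigDensity n b) * (G1 * ∫⁻ l, S.indicator J (b, l)) :=
          IH (F := fun b => G1 * ∫⁻ l, S.indicator J (b, l)) (hSJ.lintegral_prod_right'.const_mul _)
      _ = ENNReal.ofReal (specConst n m) * (G1 * ∫⁻ b, ∫⁻ l,
            (posChamber m).indicator (fun b => ENNReal.ofReal (eigDensity n b) *
              S.indicator J (b, l)) b) := by
          rw [← lintegral_indicator (measurableSet_posChamber m),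
            ← lintegral_const_mul' G1 _ ENNReal.ofReal_ne_top]
          · congr 1
            refine lintegral_congr fun b => ?_
            by_cases hb : b ∈ posChamber m
            · simp only [Set.indicator_of_mem hb]
              rw [lintegral_const_mul' _ _ ENNReal.ofReal_ne_top]
              ring
            · simp [Set.indicator_of_notMem hb]
      _ = ENNReal.ofReal (specConst n m) * (G1 * ∫⁻ l, ∫⁻ b,
            (posChamber m).indicator (fun b => ENNReal.ofReal (eigDensity n b) *
              S.indicator J (b, l)) b) := by
          rw [lintegral_lintegral_swap]
          refine Measurable.aemeasurable ?_
          have : Function.uncurry (fun (b : Fin m → ℝ) (l : Fin (m + 1) → ℝ) =>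
              (posChamber m).indicator (fun b => ENNReal.ofReal (eigDensity n b) *
              S.indicator J (b, l)) b) = (Prod.fst ⁻¹' posChamber m).indicator
              fun p => ENNReal.ofReal (eigDensity n p.1) * S.indicator J p := by
            ext ⟨b, l⟩
            by_cases hb : b ∈ posChamber m <;> simp [Set.indicator, hb]
          rw [this]
          exact (((measurable_eigDensity.comp measurable_fst).ennreal_ofReal.mul hSJ)).indicator
            (measurable_fst (measurableSet_posChamber m))
      _ = ENNReal.ofReal (specConst n m) * (G1 * ∫⁻ l in posChamber (m + 1),
            (ENNReal.ofReal (eigDensity n l) * F l) * G2) := by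
          rw [← lintegral_indicator (measurableSet_posChamber (m + 1))]
          congr 2
          refine lintegral_congr fun l => ?_
          by_cases hl : l ∈ posChamber (m + 1)
          · simp only [key, Set.indicator_of_mem hl]
            rw [lintegral_const_mul, lintegral_indicator (measurableSet_interlacingBelow l),
              lintegral_interlacingBelow hl.1]
            refine Measurable.indicator (Measurable.ennreal_ofReal
              (measurable_absVandermonde.mul ?_)) (measurableSet_interlacingBelow l)
            fun_prop
          · simp [key, Set.indicator_of_notMem hl]
      _ = ENNReal.ofReal (specConst n (m + 1)) * ∫⁻ l in posChamber (m + 1),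
            ENNReal.ofReal (eigDensity n l) * F l := by
          rw [lintegral_mul_const G2 (f := fun l => ENNReal.ofReal (eigDensity n l) * F l)
            (measurable_eigDensity.ennreal_ofReal.mul hF), specConst,
            ENNReal.ofReal_mul (specConst_pos (Nat.le_of_succ_le h)).le,
            ENNReal.ofReal_mul' (by
              have := Real.Gamma_pos_of_pos (s := ((m : ℝ) + 1) / 2) (by positivity)
              positivity)]
          have : (n - m : ℝ) = d := by rw [hn]; push_cast; ring
          rw [this, hG1, hG2]
          ring

theorem specConst_mul_gamma {n : ℕ} : ∀ {m : ℕ}, m ≤ n →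
    specConst n m * ((∏ i : Fin m, Real.Gamma ((n : ℝ) / 2 - (i : ℝ) / 2)) *
      ∏ i : Fin m, Real.Gamma (((i : ℝ) + 1) / 2)) = π ^ ((m : ℝ) * (n + 1) / 2)
  | 0, _ => by simp [specConst]
  | m + 1, h => by
    have h1 : (0 : ℝ) < (n : ℝ) / 2 - m / 2 := by
      have : (m : ℝ) + 1 ≤ n := by exact_mod_cast h
      linarith
    have h2 : (0 : ℝ) < ((m : ℝ) + 1) / 2 := by positivity
    have g1 := Real.Gamma_pos_of_pos h1
    have g2 := Real.Gamma_pos_of_pos h2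
    have ih := specConst_mul_gamma (m := m) (Nat.le_of_succ_le h)
    have e1 : ((n : ℝ) - m) / 2 = n / 2 - m / 2 := by ring
    rw [specConst, Fin.prod_univ_castSucc, Fin.prod_univ_castSucc, e1]
    simp only [Fin.val_castSucc, Fin.val_last]
    have e2 : ((m + 1 : ℕ) : ℝ) * (n + 1) / 2 =
        (m : ℝ) * (n + 1) / 2 + ((n : ℝ) / 2 - m / 2) + ((m : ℝ) + 1) / 2 := by
      push_cast; ring
    rw [e2, Real.rpow_add pi_pos, Real.rpow_add pi_pos, ← ih]
    generalize Real.Gamma ((n : ℝ) / 2 - m / 2) = x at g1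
    generalize Real.Gamma (((m : ℝ) + 1) / 2) = y at g2
    field_simp

theorem mvGamma_half (m : ℕ) : mvGamma m ((m : ℝ) / 2) =
    π ^ (((m * (m - 1) : ℕ) : ℝ) / 4) * ∏ i : Fin m, Real.Gamma (((i : ℝ) + 1) / 2) := by
  rw [mvGamma]
  congr 1
  refine Fintype.prod_equiv Fin.revPerm _ _ fun i => ?_
  congr 1
  have : ((Fin.rev i : ℕ) : ℝ) = m - (i + 1) := by
    rw [Fin.val_rev, Nat.cast_sub i.isLt]; push_cast; ring
  rw [Fin.revPerm_apply, this]
  ring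

theorem specConst_mul_mvGamma {n m : ℕ} (h : m ≤ n) :
    specConst n m * (mvGamma m ((n : ℝ) / 2) * mvGamma m ((m : ℝ) / 2)) =
      π ^ (((m * n : ℕ) : ℝ) / 2) * π ^ (((m ^ 2 : ℕ) : ℝ) / 2) := by
  have hc : ((m * (m - 1) : ℕ) : ℝ) = m * (m - 1) := by
    rcases m with _ | m
    · simp
    · push_cast; simp
  rw [mvGamma_half, mvGamma]
  have e : π ^ (((m * n : ℕ) : ℝ) / 2) * π ^ (((m ^ 2 : ℕ) : ℝ) / 2) =
      π ^ (((m * (m - 1) : ℕ) : ℝ) / 4) * π ^ (((m * (m - 1) : ℕ) : ℝ) / 4) *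
        π ^ ((m : ℝ) * (n + 1) / 2) := by
    rw [← Real.rpow_add pi_pos, ← Real.rpow_add pi_pos, ← Real.rpow_add pi_pos, hc]
    congr 1
    push_cast
    ring
  rw [e, ← specConst_mul_gamma h]
  ring

theorem prod_two_mul_eigDensity_sq {n m : ℕ} (h : m ≤ n) {a : Fin m → ℝ} (ha : a ∈ posChamber m) :
    (∏ i, (2 * a i)) * eigDensity n (fun i => a i ^ 2) =
      2 ^ m * ((∏ i, a i ^ (n - m)) * ∏ i, ∏ j ∈ Finset.Ioi i, (a i ^ 2 - a j ^ 2)) := by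
  have hs : StrictAnti fun i => a i ^ 2 := fun i j hij =>
    pow_lt_pow_left₀ (ha.1 hij) (ha.2 j).le two_ne_zero
  have hA : 0 < ∏ i, a i := Finset.prod_pos fun i _ => ha.2 i
  rw [eigDensity, absVandermonde_of_strictAnti hs, Finset.prod_mul_distrib, Finset.prod_pow,
    Finset.prod_pow, ← Real.rpow_natCast (∏ i, a i) 2, ← Real.rpow_mul hA.le]
  have : (∏ i, a i) * (∏ i, a i) ^ (((2 : ℕ) : ℝ) * (((n : ℝ) - m - 1) / 2)) =
      (∏ i, a i) ^ (n - m) := by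
    nth_rw 1 [← Real.rpow_one (∏ i, a i)]
    rw [← Real.rpow_add hA, ← Real.rpow_natCast (∏ i, a i) (n - m), Nat.cast_sub h]
    congr 1
    push_cast
    ring
  rw [← this]
  simp only [Finset.prod_const, Finset.card_univ, Fintype.card_fin]
  ring

theorem measurable_svalues {n m : ℕ} :
    Measurable (svalues : Matrix (Fin n) (Fin m) ℝ → Fin m → ℝ) := by
  have h := measurable_sortedEigs (n := n) (m := m)
  exact measurable_pi_iff.2 fun i => ((measurable_pi_apply i).comp h).sqrt

/-- The joint distribution of the singular values under Lebesgue measure. -/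
theorem lintegral_svalues {n m : ℕ} (h : m ≤ n) {G : (Fin m → ℝ) → ENNReal} (hG : Measurable G) :
    ∫⁻ X : Matrix (Fin n) (Fin m) ℝ, G (svalues X) =
      ENNReal.ofReal (2 ^ m * specConst n m) * ∫⁻ a in posChamber m,
        ENNReal.ofReal ((∏ i, a i ^ (n - m)) * ∏ i, ∏ j ∈ Finset.Ioi i, (a i ^ 2 - a j ^ 2)) *
          G a := by
  have hsq : Measurable fun l : Fin m → ℝ => fun i => √(l i) := by fun_prop
  have hmp := measurableSet_posChamber m
  have hpos : posChamber m ⊆ {p | ∀ i, 0 < p i} := fun p hp => hp.2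
  rw [show (∫⁻ X : Matrix (Fin n) (Fin m) ℝ, G (svalues X)) =
    ∫⁻ X : Matrix (Fin n) (Fin m) ℝ, (fun l => G fun i => √(l i)) (sortedEigs X) from rfl,
    lintegral_sortedEigs (F := fun l => G fun i => √(l i)) h (hG.comp hsq), mul_comm (2 ^ m) (specConst n m),
    ENNReal.ofReal_mul (specConst_pos h).le, mul_assoc]
  congr 1
  have hF : Measurable ((posChamber m).indicator fun l : Fin m → ℝ =>
      ENNReal.ofReal (eigDensity n l) * G fun i => √(l i)) :=
    (measurable_eigDensity.ennreal_ofReal.mul (hG.comp hsq)).indicator hmp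
  have := lintegral_pos_comp_sq_pi hF
  rw [setLIntegral_indicator hmp, Set.inter_eq_left.2 hpos] at this
  rw [this, ← lintegral_const_mul' _ _ ENNReal.ofReal_ne_top,
    ← lintegral_indicator (measurableSet_forall_pos m), ← lintegral_indicator hmp]
  refine lintegral_congr fun a => ?_
  by_cases ha : a ∈ posChamber m
  · have hs : (fun i => a i ^ 2) ∈ posChamber m := ⟨fun i j hij =>
      pow_lt_pow_left₀ (ha.1 hij) (ha.2 j).le two_ne_zero, fun i => pow_pos (ha.2 i) 2⟩
    have hr : (fun i => √(a i ^ 2)) = a := funext fun i => Real.sqrt_sq (ha.2 i).le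
    rw [Set.indicator_of_mem ha, Set.indicator_of_mem (hpos ha), Set.indicator_of_mem hs, hr,
      ← mul_assoc, ← mul_assoc, ← ENNReal.ofReal_prod_of_nonneg
        fun i _ => mul_nonneg two_pos.le (ha.2 i).le,
      ← ENNReal.ofReal_mul (Finset.prod_nonneg fun i _ => mul_nonneg two_pos.le (ha.2 i).le),
      prod_two_mul_eigDensity_sq h ha, ENNReal.ofReal_mul (by positivity)]
  · rw [Set.indicator_of_notMem ha, Set.indicator_apply_eq_zero]
    intro h0
    have : (fun i => a i ^ 2) ∉ posChamber m := fun hc =>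
      ha ⟨fun i j hij => lt_of_pow_lt_pow_left₀ 2 (h0 i).le (hc.1 hij), h0⟩
    rw [Set.indicator_of_notMem this, mul_zero]

instance compactSpace_orthogonalGroup (m : ℕ) : CompactSpace (orthogonalGroup (Fin m) ℝ) := by
  refine isCompact_iff_compactSpace.1 (IsCompact.of_isClosed_subset
    (isCompact_univ_pi fun _ : Fin m => isCompact_univ_pi fun _ : Fin m =>
      isCompact_Icc (a := (-1 : ℝ)) (b := 1)) (isClosed_unitary (R := Matrix (Fin m) (Fin m) ℝ)) ?_)
  intro U hU i _ j _
  exact abs_le.1 (entry_norm_bound_of_unitary hU i j)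

theorem lintegral_mul_right_orthogonalGroup {m : ℕ} (νH : Measure (orthogonalGroup (Fin m) ℝ))
    [νH.IsHaarMeasure] (V : orthogonalGroup (Fin m) ℝ)
    (f : orthogonalGroup (Fin m) ℝ → ENNReal) (hf : Measurable f) :
    ∫⁻ H, f (H * V) ∂νH = ∫⁻ H, f H ∂νH := by
  have h := MonoidHom.measurePreserving (μ := νH) (ν := νH)
    (f := (MulAut.conj V⁻¹).toMonoidHom) (by
      change Continuous fun H => V⁻¹ * H * V⁻¹⁻¹
      fun_prop) (MulAut.conj V⁻¹).surjective rfl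
  refine Eq.trans ?_ (h.lintegral_comp hf)
  refine Eq.trans ?_ (lintegral_mul_left_eq_self _ V)
  refine lintegral_congr fun H => congrArg f ?_
  simp

/-- Diagonalization of `XᵀX` with its eigenvalues in decreasing order. -/
theorem exists_orthogonalGroup_transpose_mul_self {n m : ℕ} (X : Matrix (Fin n) (Fin m) ℝ) :
    ∃ V : orthogonalGroup (Fin m) ℝ, Xᵀ * X =
      (V : Matrix (Fin m) (Fin m) ℝ) * diagonal (fun i => svalues X i ^ 2) *
        (V : Matrix (Fin m) (Fin m) ℝ)ᵀ := by
  obtain ⟨U, h1, h2, h3⟩ :=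
    exists_orthogonal_diagonalization (Matrix.isHermitian_conjTranspose_mul_self X)
  set e := (Matrix.isHermitian_conjTranspose_mul_self X).eigenvalues with he
  set σ : Fin m ≃ Fin m := Fin.revPerm.trans (Tuple.sort e) with hσ
  have hV : U.submatrix id σ * (U.submatrix id σ)ᵀ = 1 := by
    rw [transpose_submatrix, submatrix_mul_equiv, h1, submatrix_id_id]
  refine ⟨⟨U.submatrix id σ, (mem_orthogonalGroup_iff _ _).2 hV⟩, ?_⟩
  have hd : diagonal (fun i => svalues X i ^ 2) = (diagonal e).submatrix σ σ := by
    rw [submatrix_diagonal_equiv]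
    congr 1
    funext i
    exact Real.sq_sqrt (sortedEigs_nonneg X i)
  rw [← conjTranspose_eq_transpose_of_trivial X, h3, hd]
  simp only
  rw [transpose_submatrix, submatrix_mul_equiv, submatrix_mul_equiv, submatrix_id_id]

theorem svalues_mul_orthogonal {n m : ℕ} (X : Matrix (Fin n) (Fin m) ℝ)
    {H : Matrix (Fin m) (Fin m) ℝ} (h : Hᵀ * H = 1) : svalues (X * Hᵀ) = svalues X := by
  have : sortedEigs (X * Hᵀ) = sortedEigs X := by
    refine sortedEigs_congr ?_
    rw [transpose_mul, transpose_transpose, ← Matrix.mul_assoc, charpoly_mul_comm,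
      ← Matrix.mul_assoc, ← Matrix.mul_assoc, h, Matrix.one_mul]
  funext i
  rw [svalues, svalues, this]

theorem lintegral_mul_orthogonal {n m : ℕ} {H : Matrix (Fin m) (Fin m) ℝ} (h : H * Hᵀ = 1)
    {f : Matrix (Fin n) (Fin m) ℝ → ENNReal} (hf : Measurable f) :
    ∫⁻ X : Matrix (Fin n) (Fin m) ℝ, f (X * Hᵀ) = ∫⁻ X, f X := by
  have h1 : MeasurePreserving (fun x : Fin m → ℝ => H *ᵥ x) volume volume := by
    have hm : Measurable fun x : Fin m → ℝ => H *ᵥ x := by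
      exact (Continuous.matrix_mulVec continuous_const continuous_id).measurable
    refine ⟨hm, Measure.ext fun s hs => ?_⟩
    rw [← lintegral_indicator_one hs, ← lintegral_indicator_one hs, lintegral_map
      (measurable_one.indicator hs) hm]
    exact lintegral_mulVec_orthogonal h (measurable_one.indicator hs)
  have h2 : MeasurePreserving (fun (X : Fin n → Fin m → ℝ) i => H *ᵥ X i) volume volume :=
    volume_preserving_pi fun _ => h1
  refine Eq.trans ?_ (h2.lintegral_comp hf)
  refine lintegral_congr fun X => congrArg f ?_
  ext i j
  change ∑ k, X i k * H j k = ∑ k, H j k * X i k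
  exact Finset.sum_congr rfl fun k _ => mul_comm _ _

instance matSigmaFinite (n m : ℕ) :
    SigmaFinite (volume : Measure (Matrix (Fin n) (Fin m) ℝ)) :=
  inferInstanceAs (SigmaFinite (volume : Measure (Fin n → Fin m → ℝ)))

/-- Averaging a function of `XᵀX` over the orthogonal group, given the singular values of `X`. -/
theorem lintegral_svalues_mul_comp {n m : ℕ} (νH : Measure (orthogonalGroup (Fin m) ℝ))
    [νH.IsHaarMeasure] [IsProbabilityMeasure νH] {g : (Fin m → ℝ) → ENNReal} (hg : Measurable g)
    {f : Matrix (Fin m) (Fin m) ℝ → ENNReal} (hf : Measurable f) :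
    ∫⁻ X : Matrix (Fin n) (Fin m) ℝ, g (svalues X) * f (Xᵀ * X) =
      ∫⁻ X : Matrix (Fin n) (Fin m) ℝ, g (svalues X) *
        ∫⁻ H, f ((H : Matrix (Fin m) (Fin m) ℝ) * diagonal (fun i => svalues X i ^ 2) *
          (H : Matrix (Fin m) (Fin m) ℝ)ᵀ) ∂νH := by
  have hm : Measurable fun p : Matrix (Fin n) (Fin m) ℝ × orthogonalGroup (Fin m) ℝ =>
      g (svalues p.1) * f ((p.2 : Matrix (Fin m) (Fin m) ℝ) * (p.1ᵀ * p.1) *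
        (p.2 : Matrix (Fin m) (Fin m) ℝ)ᵀ) := by
    refine (hg.comp (measurable_svalues.comp measurable_fst)).mul (hf.comp ?_)
    refine measurable_pi_iff.2 fun i => measurable_pi_iff.2 fun j => ?_
    have h1 : ∀ i j, Measurable fun p : Matrix (Fin n) (Fin m) ℝ × orthogonalGroup (Fin m) ℝ =>
        p.1 i j := fun i j =>
      (measurable_pi_apply j).comp ((measurable_pi_apply i).comp measurable_fst)
    have h2 : ∀ i j, Measurable fun p : Matrix (Fin n) (Fin m) ℝ × orthogonalGroup (Fin m) ℝ =>
        (p.2 : Matrix (Fin m) (Fin m) ℝ) i j := fun i j =>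
      (measurable_pi_apply j).comp ((measurable_pi_apply i).comp
        (measurable_subtype_coe.comp measurable_snd))
    simp only [mul_apply, transpose_apply]
    exact Finset.measurable_fun_sum _ fun k _ => (Finset.measurable_fun_sum _ fun l _ =>
      (h2 i l).mul (Finset.measurable_fun_sum _ fun q _ => (h1 q l).mul (h1 q k))).mul (h2 j k)
  have hm0 : Measurable fun X : Matrix (Fin n) (Fin m) ℝ => g (svalues X) * f (Xᵀ * X) := by
    have := hm.comp (measurable_prodMk_right (y := (1 : orthogonalGroup (Fin m) ℝ)))
    simpa [Function.comp_def] using this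
  have step : ∀ H : orthogonalGroup (Fin m) ℝ,
      ∫⁻ X : Matrix (Fin n) (Fin m) ℝ, g (svalues X) * f (Xᵀ * X) =
      ∫⁻ X : Matrix (Fin n) (Fin m) ℝ, g (svalues X) *
        f ((H : Matrix (Fin m) (Fin m) ℝ) * (Xᵀ * X) * (H : Matrix (Fin m) (Fin m) ℝ)ᵀ) := by
    intro H
    have h1 := (mem_orthogonalGroup_iff _ _).1 H.2
    have h2 := (mem_orthogonalGroup_iff' _ _).1 H.2
    rw [← lintegral_mul_orthogonal h1 hm0]
    refine lintegral_congr fun X => ?_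
    rw [svalues_mul_orthogonal X h2, transpose_mul, transpose_transpose]
    simp only [Matrix.mul_assoc]
  calc ∫⁻ X : Matrix (Fin n) (Fin m) ℝ, g (svalues X) * f (Xᵀ * X)
      = ∫⁻ _ : orthogonalGroup (Fin m) ℝ,
          ∫⁻ X : Matrix (Fin n) (Fin m) ℝ, g (svalues X) * f (Xᵀ * X) ∂volume ∂νH := by simp
    _ = ∫⁻ H : orthogonalGroup (Fin m) ℝ, ∫⁻ X : Matrix (Fin n) (Fin m) ℝ, g (svalues X) *
          f ((H : Matrix (Fin m) (Fin m) ℝ) * (Xᵀ * X) *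
            (H : Matrix (Fin m) (Fin m) ℝ)ᵀ) ∂volume ∂νH := lintegral_congr step
    _ = ∫⁻ X : Matrix (Fin n) (Fin m) ℝ, ∫⁻ H : orthogonalGroup (Fin m) ℝ, g (svalues X) *
          f ((H : Matrix (Fin m) (Fin m) ℝ) * (Xᵀ * X) *
            (H : Matrix (Fin m) (Fin m) ℝ)ᵀ) ∂νH ∂volume :=
        (lintegral_lintegral_swap hm.aemeasurable).symm
    _ = _ := by
        refine lintegral_congr fun X => ?_
        have hmul : ∀ A : Matrix (Fin m) (Fin m) ℝ, Measurable fun H : orthogonalGroup (Fin m) ℝ =>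
            f ((H : Matrix (Fin m) (Fin m) ℝ) * A * (H : Matrix (Fin m) (Fin m) ℝ)ᵀ) := by
          intro A
          refine hf.comp (Continuous.measurable ?_)
          fun_prop
        rw [lintegral_const_mul _ (hmul _)]
        congr 1
        obtain ⟨V, hV⟩ := exists_orthogonalGroup_transpose_mul_self X
        rw [hV]
        refine Eq.trans ?_ (lintegral_mul_right_orthogonalGroup νH V _ (hmul _))
        refine lintegral_congr fun H => congrArg f ?_
        simp [transpose_mul, Matrix.mul_assoc]

theorem continuous_princMinor {m : ℕ} (i : Fin m) :
    Continuous fun A : Matrix (Fin m) (Fin m) ℝ => princMinor A i := by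
  unfold princMinor
  fun_prop

theorem measurable_hwv {m : ℕ} (κ : Fin m → ℝ) :
    Measurable (hwv κ : Matrix (Fin m) (Fin m) ℝ → ℝ) := by
  unfold hwv
  exact Finset.measurable_fun_prod _ fun i _ => (continuous_princMinor i).measurable.pow_const _

theorem princMinor_pos {m : ℕ} {A : Matrix (Fin m) (Fin m) ℝ} (hA : A.PosDef) (i : Fin m) :
    0 < princMinor A i :=
  (hA.submatrix (Fin.castLE_injective i.isLt)).det_pos

theorem hwv_pos {m : ℕ} (κ : Fin m → ℝ) {A : Matrix (Fin m) (Fin m) ℝ} (hA : A.PosDef) :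
    0 < hwv κ A :=
  Finset.prod_pos fun i _ => Real.rpow_pos_of_pos (princMinor_pos hA i) _

theorem posDef_orthogonal_conj_diagonal {m : ℕ} (H : orthogonalGroup (Fin m) ℝ) {d : Fin m → ℝ}
    (hd : ∀ i, 0 < d i) : ((H : Matrix (Fin m) (Fin m) ℝ) * diagonal d *
      (H : Matrix (Fin m) (Fin m) ℝ)ᵀ).PosDef := by
  have h1 := (mem_orthogonalGroup_iff _ _).1 H.2
  have hu : IsUnit (H : Matrix (Fin m) (Fin m) ℝ) :=
    ⟨⟨H, (H : Matrix (Fin m) (Fin m) ℝ)ᵀ, h1, (mem_orthogonalGroup_iff' _ _).1 H.2⟩, rfl⟩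
  rw [← conjTranspose_eq_transpose_of_trivial]
  exact (PosDef.diagonal hd).mul_mul_conjTranspose_same
    (vecMul_injective_of_isUnit hu)

theorem ofReal_integral_hwv {m : ℕ} (κ : Fin m → ℝ) (νH : Measure (orthogonalGroup (Fin m) ℝ))
    [IsFiniteMeasure νH] {d : Fin m → ℝ} (hd : ∀ i, 0 < d i) :
    ENNReal.ofReal (∫ H : orthogonalGroup (Fin m) ℝ, hwv κ ((H : Matrix (Fin m) (Fin m) ℝ) *
        diagonal d * (H : Matrix (Fin m) (Fin m) ℝ)ᵀ) ∂νH) =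
      ∫⁻ H : orthogonalGroup (Fin m) ℝ, ENNReal.ofReal (hwv κ ((H : Matrix (Fin m) (Fin m) ℝ) *
        diagonal d * (H : Matrix (Fin m) (Fin m) ℝ)ᵀ)) ∂νH := by
  have hc : Continuous fun H : orthogonalGroup (Fin m) ℝ =>
      hwv κ ((H : Matrix (Fin m) (Fin m) ℝ) * diagonal d * (H : Matrix (Fin m) (Fin m) ℝ)ᵀ) := by
    refine continuous_finsetProd _ fun i _ => Continuous.rpow_const
      ((continuous_princMinor i).comp (by fun_prop)) fun H =>
        Or.inl (princMinor_pos (posDef_orthogonal_conj_diagonal H hd) i).ne'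
  refine ofReal_integral_eq_lintegral_ofReal ?_
    (Filter.Eventually.of_forall fun H => (hwv_pos κ (posDef_orthogonal_conj_diagonal H hd)).le)
  rw [← integrableOn_univ]
  exact hc.continuousOn.integrableOn_compact isCompact_univ

theorem measurable_lintegral_hwv {m : ℕ} (κ : Fin m → ℝ)
    (νH : Measure (orthogonalGroup (Fin m) ℝ)) [SFinite νH] :
    Measurable fun a : Fin m → ℝ => ∫⁻ H : orthogonalGroup (Fin m) ℝ,
      ENNReal.ofReal (hwv κ ((H : Matrix (Fin m) (Fin m) ℝ) * diagonal (fun i => a i ^ 2) *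
        (H : Matrix (Fin m) (Fin m) ℝ)ᵀ)) ∂νH := by
  refine Measurable.lintegral_prod_right' (f := fun p : (Fin m → ℝ) × orthogonalGroup (Fin m) ℝ =>
    ENNReal.ofReal (hwv κ ((p.2 : Matrix (Fin m) (Fin m) ℝ) * diagonal (fun i => p.1 i ^ 2) *
        (p.2 : Matrix (Fin m) (Fin m) ℝ)ᵀ))) (((measurable_hwv κ).comp ?_).ennreal_ofReal)
  have h1 : ∀ i, Measurable fun p : (Fin m → ℝ) × orthogonalGroup (Fin m) ℝ => p.1 i :=
    fun i => (measurable_pi_apply i).comp measurable_fst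
  have h2 : ∀ i j, Measurable fun p : (Fin m → ℝ) × orthogonalGroup (Fin m) ℝ =>
      (p.2 : Matrix (Fin m) (Fin m) ℝ) i j := fun i j =>
    (measurable_pi_apply j).comp ((measurable_pi_apply i).comp
      (measurable_subtype_coe.comp measurable_snd))
  refine measurable_pi_iff.2 fun i => measurable_pi_iff.2 fun j => ?_
  simp_rw [mul_apply (M := _ * diagonal _), mul_diagonal, transpose_apply]
  exact Finset.measurable_fun_sum _ fun k _ => ((h2 i k).mul ((h1 k).pow_const 2)).mul (h2 j k)

theorem trace_transpose_mul_self_eq {n m : ℕ} (X : Matrix (Fin n) (Fin m) ℝ) :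
    (Xᵀ * X).trace = ∑ i, svalues X i ^ 2 := by
  obtain ⟨V, hV⟩ := exists_orthogonalGroup_transpose_mul_self X
  rw [hV, trace_mul_comm, ← Matrix.mul_assoc, (mem_orthogonalGroup_iff' _ _).1 V.2,
    Matrix.one_mul, trace_diagonal]

theorem ae_svalues_mem_posChamber {n m : ℕ} (h : m ≤ n) :
    ∀ᵐ X : Matrix (Fin n) (Fin m) ℝ, svalues X ∈ posChamber m := by
  have hmc := (measurableSet_posChamber m).compl
  have := lintegral_svalues h (G := (posChamber m)ᶜ.indicator fun _ => 1)
    (measurable_const.indicator hmc)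
  rw [setLIntegral_congr_fun (g := fun _ => 0) (measurableSet_posChamber m)
    (fun l hl => by simp [hl])] at this
  simp only [lintegral_zero, mul_zero] at this
  replace this := (lintegral_eq_zero_iff
    (f := fun X : Matrix (Fin n) (Fin m) ℝ =>
      (posChamber m)ᶜ.indicator (fun _ => (1 : ENNReal)) (svalues X))
    ((measurable_const.indicator hmc).comp measurable_svalues)).1 this
  filter_upwards [this] with Y hY
  by_contra hc
  simp [hc] at hY

theorem posDef_transpose_mul_self {n m : ℕ} {X : Matrix (Fin n) (Fin m) ℝ}
    (h : svalues X ∈ posChamber m) : (Xᵀ * X).PosDef := by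
  obtain ⟨V, hV⟩ := exists_orthogonalGroup_transpose_mul_self X
  rw [hV]
  exact posDef_orthogonal_conj_diagonal V fun i => pow_pos (h.2 i) 2

theorem mvGamma_pos {m : ℕ} {a : ℝ} (h : ∀ i : Fin m, 0 < a - (i : ℝ) / 2) : 0 < mvGamma m a :=
  mul_pos (Real.rpow_pos_of_pos pi_pos _)
    (Finset.prod_pos fun i _ => Real.Gamma_pos_of_pos (h i))

theorem mvGammaI_pos {m : ℕ} {a : ℝ} {τ : Fin m → ℝ} (h : ∀ i : Fin m, 0 < a + τ i - (i : ℝ) / 2) :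
    0 < mvGammaI m a τ :=
  mul_pos (Real.rpow_pos_of_pos pi_pos _)
    (Finset.prod_pos fun i _ => Real.Gamma_pos_of_pos (h i))

theorem natCast_half_sub_pos {m N : ℕ} (h : m ≤ N) (i : Fin m) :
    0 < (N : ℝ) / 2 - (i : ℝ) / 2 := by
  have : (i : ℝ) + 1 ≤ N := by exact_mod_cast i.isLt.trans_le h
  linarith

/-- The normalizing constant of the standard matrix multivariate T-Riesz type I density. -/
noncomputable def tRieszIConst (n m : ℕ) (ν k ρ : ℝ) (τ : Fin m → ℝ) : ℝ :=
  mvGamma m ((n : ℝ) / 2) * Real.Gamma ((ν + (m * n : ℕ)) / 2 + k + ∑ i, τ i) *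
      ρ ^ (((m * n : ℕ) : ℝ) / 2 + ∑ i, τ i) /
    (π ^ (((m * n : ℕ) : ℝ) / 2) * mvGammaI m ((n : ℝ) / 2) τ * Real.Gamma (ν / 2 + k))

theorem gamma_argument_pos {n m : ℕ} {ν k : ℝ} {τ : Fin m → ℝ} (hνk : 0 < ν / 2 + k)
    (hτ : ∀ i : Fin m, 0 < (n : ℝ) / 2 + τ i - (i : ℝ) / 2) :
    0 < (ν + (m * n : ℕ)) / 2 + k + ∑ i, τ i := by
  have h : 0 ≤ ∑ i : Fin m, ((n : ℝ) / 2 + τ i) := Finset.sum_nonneg fun i _ => by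
    have := hτ i
    have : (0 : ℝ) ≤ (i : ℝ) / 2 := by positivity
    linarith
  rw [Finset.sum_add_distrib] at h
  simp only [Finset.sum_const, Finset.card_univ, Fintype.card_fin, nsmul_eq_mul] at h
  push_cast
  linarith

theorem tRieszIConst_pos {n m : ℕ} (hmn : m ≤ n) {ν k ρ : ℝ} (hρ : 0 < ρ) (hνk : 0 < ν / 2 + k)
    {τ : Fin m → ℝ} (hτ : ∀ i : Fin m, 0 < (n : ℝ) / 2 + τ i - (i : ℝ) / 2) :
    0 < tRieszIConst n m ν k ρ τ := by
  have h1 := mvGamma_pos (natCast_half_sub_pos hmn)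
  have h2 := mvGammaI_pos hτ
  have h3 := Real.Gamma_pos_of_pos hνk
  have h4 := Real.Gamma_pos_of_pos (gamma_argument_pos hνk hτ)
  unfold tRieszIConst
  positivity

theorem tRieszIDen_standard (n m : ℕ) (ν k ρ : ℝ) (τ : Fin m → ℝ)
    (X : Matrix (Fin n) (Fin m) ℝ) :
    tRieszIDen n m ν k ρ τ 0 1 1 1 X = tRieszIConst n m ν k ρ τ *
      (1 + ρ * ∑ i, svalues X i ^ 2) ^ (-((ν + (m * n : ℕ)) / 2 + k + ∑ i, τ i)) *
        hwv τ (Xᵀ * X) := by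
  rw [← trace_transpose_mul_self_eq]
  simp [tRieszIDen, tRieszIConst]

theorem two_pow_mul_specConst_mul_tRieszIConst {n m : ℕ} (hmn : m ≤ n) (ν k ρ : ℝ)
    (τ : Fin m → ℝ) :
    2 ^ m * specConst n m * tRieszIConst n m ν k ρ τ =
      (2 : ℝ) ^ m * π ^ (((m ^ 2 : ℕ) : ℝ) / 2) *
        Real.Gamma ((ν + (m * n : ℕ)) / 2 + k + ∑ i, τ i) *
        ρ ^ (((m * n : ℕ) : ℝ) / 2 + ∑ i, τ i) /
        (mvGamma m ((m : ℝ) / 2) * mvGammaI m ((n : ℝ) / 2) τ * Real.Gamma (ν / 2 + k)) := by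
  have h := specConst_mul_mvGamma hmn
  have h1 := (mvGamma_pos (natCast_half_sub_pos (le_refl m))).ne'
  have h2 : π ^ (((m * n : ℕ) : ℝ) / 2) ≠ 0 := (Real.rpow_pos_of_pos pi_pos _).ne'
  have h3 : π ^ (((m ^ 2 : ℕ) : ℝ) / 2) =
      specConst n m * (mvGamma m ((n : ℝ) / 2) * mvGamma m ((m : ℝ) / 2)) /
        π ^ (((m * n : ℕ) : ℝ) / 2) := by
    rw [h]; field_simp
  rw [tRieszIConst, h3]
  generalize mvGamma m ((n : ℝ) / 2) = x1
  generalize mvGammaI m ((n : ℝ) / 2) τ = x2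
  generalize mvGamma m ((m : ℝ) / 2) = x3 at h1
  generalize Real.Gamma (ν / 2 + k) = x4
  generalize π ^ (((m * n : ℕ) : ℝ) / 2) = x5 at h2
  field_simp

/-- joint density of the singular values of
`T ~ MTR^I(ν, k, τ, ρ, 0, I_n, I_m)`. -/
theorem stmt_14 (n m : ℕ) (hm : 1 ≤ m) (hmn : m ≤ n)
    (ρ k ν : ℝ) (hρ : 0 < ρ) (hν : 0 < ν) (hνk : 0 < ν / 2 + k)
    (τ : Fin m → ℝ) (hτ : ∀ i : Fin m, 0 < (n : ℝ) / 2 + τ i - (i : ℝ) / 2)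
    {Ω : Type*} [MeasurableSpace Ω] (P : Measure Ω) [IsProbabilityMeasure P]
    (T : Ω → Matrix (Fin n) (Fin m) ℝ)
    (hT : Measure.map T P =
      volume.withDensity fun t => ENNReal.ofReal (tRieszIDen n m ν k ρ τ 0 1 1 1 t))
    (νH : Measure (Matrix.orthogonalGroup (Fin m) ℝ))
    [νH.IsHaarMeasure] [IsProbabilityMeasure νH] :
    Measure.map (fun ω => svalues (T ω)) P =
      (volume.restrict {α : Fin m → ℝ | StrictAnti α ∧ ∀ i, 0 < α i}).withDensity
        fun α => ENNReal.ofReal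
          ((2 : ℝ) ^ m * Real.pi ^ (((m ^ 2 : ℕ) : ℝ) / 2) *
              Real.Gamma ((ν + (m * n : ℕ)) / 2 + k + ∑ i, τ i) *
              ρ ^ (((m * n : ℕ) : ℝ) / 2 + ∑ i, τ i) /
              (mvGamma m ((m : ℝ) / 2) * mvGammaI m ((n : ℝ) / 2) τ *
                Real.Gamma (ν / 2 + k)) *
            (∏ i : Fin m, α i ^ (n - m)) *
            (1 + ρ * ∑ i : Fin m, α i ^ 2) ^
              (-((ν + (m * n : ℕ)) / 2 + k + ∑ i, τ i)) *
            (∏ i : Fin m, ∏ j ∈ Finset.Ioi i, (α i ^ 2 - α j ^ 2)) *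
            ∫ H : Matrix.orthogonalGroup (Fin m) ℝ,
              hwv τ ((H : Matrix (Fin m) (Fin m) ℝ) *
                Matrix.diagonal (fun i => α i ^ 2) *
                (H : Matrix (Fin m) (Fin m) ℝ)ᵀ) ∂νH) := by
  set e : ℝ := -((ν + (m * n : ℕ)) / 2 + k + ∑ i, τ i) with he
  set c : ℝ := tRieszIConst n m ν k ρ τ with hc
  have hc0 : 0 < c := tRieszIConst_pos hmn hρ hνk hτ
  have hbase : ∀ a : Fin m → ℝ, 0 < 1 + ρ * ∑ i, a i ^ 2 := fun a => by positivity
  have hpow : ∀ a : Fin m → ℝ, 0 < c * (1 + ρ * ∑ i, a i ^ 2) ^ e := fun a =>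
    mul_pos hc0 (Real.rpow_pos_of_pos (hbase a) _)
  set w : (Fin m → ℝ) → ENNReal := fun a => ENNReal.ofReal (c * (1 + ρ * ∑ i, a i ^ 2) ^ e)
    with hw
  have hwm : Measurable w := by
    rw [hw]
    fun_prop
  have hden : ∀ X : Matrix (Fin n) (Fin m) ℝ, ENNReal.ofReal (tRieszIDen n m ν k ρ τ 0 1 1 1 X) =
      w (svalues X) * ENNReal.ofReal (hwv τ (Xᵀ * X)) := fun X => by
    rw [tRieszIDen_standard, ENNReal.ofReal_mul (hpow _).le]
  have hfm : Measurable fun A : Matrix (Fin m) (Fin m) ℝ => ENNReal.ofReal (hwv τ A) :=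
    (measurable_hwv τ).ennreal_ofReal
  have hAT : AEMeasurable T P := by
    by_contra hcon
    rw [Measure.map_of_not_aemeasurable hcon] at hT
    have hmul : Measurable fun X : Matrix (Fin n) (Fin m) ℝ => Xᵀ * X :=
      Continuous.measurable (by fun_prop)
    have hdm : Measurable fun X : Matrix (Fin n) (Fin m) ℝ =>
        ENNReal.ofReal (tRieszIDen n m ν k ρ τ 0 1 1 1 X) := by
      simp_rw [hden]
      exact (hwm.comp measurable_svalues).mul (hfm.comp hmul)
    have h0 := (withDensity_eq_zero_iff hdm.aemeasurable).1 hT.symm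
    have hfalse : ∀ᵐ _ : Matrix (Fin n) (Fin m) ℝ, False := by
      filter_upwards [h0, ae_svalues_mem_posChamber hmn] with X hX hX2
      rw [Pi.zero_apply, hden, mul_eq_zero, ENNReal.ofReal_eq_zero, ENNReal.ofReal_eq_zero] at hX
      rcases hX with hX | hX
      · exact absurd (hpow _) hX.not_gt
      · exact absurd (hwv_pos τ (posDef_transpose_mul_self hX2)) hX.not_gt
    have huniv : (volume : Measure (Fin n → Fin m → ℝ)) Set.univ = 0 := by
      have := ae_iff.1 hfalse
      simp only [not_false_eq_true, Set.ofPred_true] at this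
      exact this
    exact isOpen_univ.measure_ne_zero volume Set.univ_nonempty huniv
  have hmap : Measure.map (fun ω => svalues (T ω)) P = (Measure.map T P).map svalues :=
    (AEMeasurable.map_map_of_aemeasurable measurable_svalues.aemeasurable hAT).symm
  rw [hmap, hT]
  ext s hs
  have hgm : Measurable (s.indicator w) := hwm.indicator hs
  rw [Measure.map_apply measurable_svalues hs, withDensity_apply _ (measurable_svalues hs),
    withDensity_apply _ hs, ← lintegral_indicator (measurable_svalues hs),
    ← lintegral_indicator hs]
  have h1 : ∀ X : Matrix (Fin n) (Fin m) ℝ, (svalues ⁻¹' s).indicator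
      (fun X => ENNReal.ofReal (tRieszIDen n m ν k ρ τ 0 1 1 1 X)) X =
      s.indicator w (svalues X) * ENNReal.ofReal (hwv τ (Xᵀ * X)) := fun X => by
    by_cases hX : svalues X ∈ s
    · rw [Set.indicator_of_mem hX, Set.indicator_of_mem (Set.mem_preimage.2 hX), hden]
    · rw [Set.indicator_of_notMem hX, zero_mul]
      exact Set.indicator_of_notMem (s := svalues ⁻¹' s) hX _
  rw [lintegral_congr h1, lintegral_svalues_mul_comp νH hgm hfm,
    lintegral_svalues (G := fun a => s.indicator w a * ∫⁻ H : orthogonalGroup (Fin m) ℝ,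
      ENNReal.ofReal (hwv τ ((H : Matrix (Fin m) (Fin m) ℝ) * diagonal (fun i => a i ^ 2) *
        (H : Matrix (Fin m) (Fin m) ℝ)ᵀ)) ∂νH) hmn (hgm.mul (measurable_lintegral_hwv τ νH)),
    ← lintegral_const_mul' _ _ ENNReal.ofReal_ne_top]
  refine setLIntegral_congr_fun (measurableSet_posChamber m) fun a ha => ?_
  have hK : (0 : ℝ) ≤ 2 ^ m * specConst n m := mul_nonneg (by positivity) (specConst_pos hmn).le
  have hV : 0 ≤ (∏ i, a i ^ (n - m)) * ∏ i, ∏ j ∈ Finset.Ioi i, (a i ^ 2 - a j ^ 2) :=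
    mul_nonneg (Finset.prod_nonneg fun i _ => pow_nonneg (ha.2 i).le _)
      (Finset.prod_nonneg fun i _ => Finset.prod_nonneg fun j hj => sub_nonneg.2
        (pow_le_pow_left₀ (ha.2 j).le (ha.1 (Finset.mem_Ioi.1 hj)).le 2))
  by_cases has : a ∈ s
  · simp only [Set.indicator_of_mem has, hw]
    rw [← ofReal_integral_hwv τ νH fun i => pow_pos (ha.2 i) 2,
      ← ENNReal.ofReal_mul (hpow a).le, ← ENNReal.ofReal_mul hV, ← ENNReal.ofReal_mul hK,
      ← two_pow_mul_specConst_mul_tRieszIConst hmn]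
    congr 1
    ring
  · simp [Set.indicator_of_notMem has]
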